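/- arXiv:2506.04087 — 3 statements merged into one kernel-verified Lean document; each statement's English description precedes it below -/
import Mathlib

section
/- There exist infinitely many prime numbers p ≡ 1 (mod 4) with the following property: there exists an integer c_p with gcd(c_p, p) = 1 such that for every pair of integers X, Y with 0 ≤ X, Y ≤ p − 1, the square B_{X,Y}(√(⌊0.1·log p⌋)) contains at most one point of the modular hyperbola H_p^{c_p}, i.e. |H_p^{c_p} ∩ B_{X,Y}(√(⌊0.1·log p⌋))| ≤ 1. -/
/-- The modular hyperbola `H_p^c`: pairs `(x, y)` with `0 ≤ x, y ≤ p - 1` and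
`x * y ≡ c (mod p)`. -/
def ModularHyperbola (p : ℕ) (c : ℤ) : Set (ℤ × ℤ) :=
  {q : ℤ × ℤ | 0 ≤ q.1 ∧ q.1 ≤ (p : ℤ) - 1 ∧ 0 ≤ q.2 ∧ q.2 ≤ (p : ℤ) - 1 ∧
    q.1 * q.2 ≡ c [ZMOD (p : ℤ)]}

/-- The square `B_{X,Y}(H)`: pairs `(x, y)` with `0 ≤ x, y ≤ p - 1` such that
`x ≡ X + i (mod p)` and `y ≡ Y + j (mod p)` for some integers `0 ≤ i, j ≤ H`. -/
def SquareBox (p : ℕ) (X Y : ℤ) (H : ℝ) : Set (ℤ × ℤ) :=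
  {q : ℤ × ℤ | 0 ≤ q.1 ∧ q.1 ≤ (p : ℤ) - 1 ∧ 0 ≤ q.2 ∧ q.2 ≤ (p : ℤ) - 1 ∧
    ∃ i j : ℤ, 0 ≤ i ∧ (i : ℝ) ≤ H ∧ 0 ≤ j ∧ (j : ℝ) ≤ H ∧
      q.1 ≡ X + i [ZMOD (p : ℤ)] ∧ q.2 ≡ Y + j [ZMOD (p : ℤ)]}

open Polynomial

/-- The first-order operator sending `s` to `f * derivative s + c * derivative f * s`. -/
noncomputable def twistedDerivative {F : Type*} [Field F] (f : F[X]) (c : F) : F[X] →ₗ[F] F[X] :=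
  LinearMap.mulLeft F f ∘ₗ derivative + LinearMap.mulLeft F (C c * derivative f)

section

variable {F : Type*} [Field F]

lemma twistedDerivative_apply (f : F[X]) (c : F) (s : F[X]) :
    twistedDerivative f c s = f * derivative s + C c * derivative f * s := rfl

lemma twistedDerivative_mem_degreeLT (f : F[X]) (c : F) {s : F[X]} {n : ℕ}
    (hs : s ∈ degreeLT F n) : twistedDerivative f c s ∈ degreeLT F (n + f.natDegree) := by
  rcases eq_or_ne s 0 with rfl | hs0
  · simp
  rw [mem_degreeLT, degree_eq_natDegree hs0, Nat.cast_lt] at hs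
  have h1 : (f * derivative s).natDegree ≤ f.natDegree + s.natDegree :=
    natDegree_mul_le.trans (by gcongr; exact (natDegree_derivative_le s).trans (Nat.sub_le _ _))
  have h2 : (C c * derivative f * s).natDegree ≤ f.natDegree + s.natDegree :=
    natDegree_mul_le.trans (by
      gcongr
      exact (natDegree_C_mul_le _ _).trans ((natDegree_derivative_le f).trans (Nat.sub_le _ _)))
  rw [mem_degreeLT]
  refine degree_le_natDegree.trans_lt ?_
  rw [Nat.cast_lt, twistedDerivative_apply]
  have := natDegree_add_le_of_degree_le h1 h2
  omega

lemma twistedDerivative_pow_mem_degreeLT (f : F[X]) (c : F) {s : F[X]} {n : ℕ}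
    (hs : s ∈ degreeLT F n) (k : ℕ) :
    (twistedDerivative f c ^ k) s ∈ degreeLT F (n + k * f.natDegree) := by
  induction k with
  | zero => simpa using hs
  | succ k ih =>
    rw [pow_succ', Module.End.mul_apply, add_mul, one_mul, ← add_assoc]
    exact twistedDerivative_mem_degreeLT f c ih

/-- Vanishing of the iterates of `f * d/dX` at `x` forces a zero of high order at `x`. -/
lemma X_sub_C_pow_dvd_of_twistedDerivative_pow {p : ℕ} [CharP F p] (f : F[X]) {x : F}
    (hfx : f.eval x ≠ 0) {M : ℕ} (hM : M < p) (R : F[X])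
    (h : ∀ k < M, ((twistedDerivative f 0 ^ k) R).eval x = 0) : (X - C x) ^ M ∣ R := by
  induction M generalizing R with
  | zero => simp
  | succ M ih =>
    rcases eq_or_ne R 0 with rfl | hR
    · simp
    have h0 : R.IsRoot x := by simpa using h 0 (by omega)
    have hdvd : (X - C x) ^ M ∣ twistedDerivative f 0 R := by
      refine ih (by omega) _ fun k hk => ?_
      have := h (k + 1) (by omega)
      rwa [pow_succ, Module.End.mul_apply] at this
    have hcop : IsCoprime ((X - C x) ^ M) f := by
      refine IsCoprime.pow_left ?_
      rw [(irreducible_X_sub_C x).coprime_iff_not_dvd, dvd_iff_isRoot]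
      exact hfx
    have hdvd' : (X - C x) ^ M ∣ derivative R := by
      refine hcop.dvd_of_dvd_mul_left ?_
      simpa [twistedDerivative_apply] using hdvd
    rw [← le_rootMultiplicity_iff hR]
    by_contra! hlt
    obtain ⟨Q, hQ, hQx⟩ := exists_eq_pow_rootMultiplicity_mul_and_not_dvd R hR x
    obtain ⟨m, hm⟩ := Nat.exists_eq_add_one_of_ne_zero ((rootMultiplicity_pos hR).2 h0).ne'
    rw [hm] at hQ hlt
    have hne : ((m + 1 : ℕ) : F) ≠ 0 := by
      rw [Ne, CharP.cast_eq_zero_iff F p]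
      intro hd
      have := Nat.le_of_dvd (by omega) hd
      omega
    have hder : derivative R = (X - C x) ^ m * (C ((m + 1 : ℕ) : F) * Q +
        (X - C x) * derivative Q) := by
      conv_lhs => rw [hQ]
      rw [derivative_mul, derivative_X_sub_C_pow]
      simp only [Nat.add_sub_cancel, C_eq_natCast]
      ring
    have h1 : (X - C x) ^ m * (X - C x) ∣ derivative R := by
      rw [← pow_succ]
      exact (pow_dvd_pow _ (by omega)).trans hdvd'
    rw [hder, mul_dvd_mul_iff_left (pow_ne_zero _ (X_sub_C_ne_zero x)),
      dvd_add_left (dvd_mul_right _ _), dvd_iff_isRoot, IsRoot, eval_mul, eval_C,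
      mul_eq_zero, or_iff_right hne] at h1
    exact hQx (dvd_iff_isRoot.2 h1)

/-- A polynomial with a simple root times a square is not a scalar times a square. -/
lemma eq_zero_of_mul_sq_eq_C_mul_sq {f : F[X]} {a : F} (ha : f.rootMultiplicity a = 1) {c : F}
    (hc : c ≠ 0) {r s : F[X]} (h : f * r ^ 2 = C c * s ^ 2) : r = 0 ∧ s = 0 := by
  have hf : f ≠ 0 := by
    rintro rfl
    simp at ha
  have hC : C c ≠ 0 := by simpa using hc
  rcases eq_or_ne r 0 with rfl | hr
  · simpa [hc] using h.symm
  exfalso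
  have hs : s ≠ 0 := by
    rintro rfl
    simp [hf, hr] at h
  have := congrArg (rootMultiplicity a) h
  rw [rootMultiplicity_mul (mul_ne_zero hf (pow_ne_zero 2 hr)),
    rootMultiplicity_mul (mul_ne_zero hC (pow_ne_zero 2 hs)), ha, rootMultiplicity_C,
    pow_two, pow_two, rootMultiplicity_mul (mul_ne_zero hr hr),
    rootMultiplicity_mul (mul_ne_zero hs hs)] at this
  omega

end

section

variable {p : ℕ} [Fact p.Prime]

/-- The powers `X ^ (p * j)` are linearly independent over polynomials of low degree together with
their multiples by `f ^ ((p - 1) / 2)`. -/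
lemma eq_zero_of_sum_mul_X_pow_eq_zero (hp : p ≠ 2) {f : (ZMod p)[X]} {a : ZMod p}
    (ha : f.rootMultiplicity a = 1) (hf0 : f.eval 0 ≠ 0) {B : ℕ} (hB : 2 * B + f.natDegree ≤ p)
    (J : ℕ) (r s : ℕ → (ZMod p)[X]) (hr : ∀ j < J, r j ∈ degreeLT (ZMod p) B)
    (hs : ∀ j < J, s j ∈ degreeLT (ZMod p) B)
    (h : ∑ j ∈ Finset.range J, (r j + s j * f ^ (p / 2)) * X ^ (p * j) = 0) :
    ∀ j < J, r j = 0 ∧ s j = 0 := by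
  have hpp : p.Prime := Fact.out
  induction J generalizing r s with
  | zero => simp
  | succ J ih =>
    have hXp : (X : (ZMod p)[X]) ^ p ≠ 0 := pow_ne_zero _ X_ne_zero
    have hshift : ∀ u : ℕ → (ZMod p)[X], ∑ j ∈ Finset.range (J + 1), u j * X ^ (p * j) =
        u 0 + X ^ p * ∑ j ∈ Finset.range J, u (j + 1) * X ^ (p * j) := by
      intro u
      rw [Finset.sum_range_succ', Finset.mul_sum, add_comm]
      simp only [mul_zero, pow_zero, mul_one]
      congr 1
      refine Finset.sum_congr rfl fun j _ => ?_
      ring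
    have h00 : r 0 = 0 ∧ s 0 = 0 := by
      set A := ∑ j ∈ Finset.range J, r (j + 1) * X ^ (p * j) with hA
      set A' := ∑ j ∈ Finset.range J, s (j + 1) * X ^ (p * j) with hA'
      have h1 : r 0 + X ^ p * A + (s 0 + X ^ p * A') * f ^ (p / 2) = 0 := by
        rw [← hshift r, ← hshift s, Finset.sum_mul, ← Finset.sum_add_distrib, ← h]
        refine Finset.sum_congr rfl fun j _ => ?_
        ring
      obtain ⟨E, hE⟩ : (X : (ZMod p)[X]) ^ p ∣ f ^ p - C (f.eval 0) := by
        have h2 : (X : (ZMod p)[X]) ∣ f - C (f.eval 0) := by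
          rw [X_dvd_iff]
          simp [coeff_zero_eq_eval_zero]
        have h3 := map_dvd (expand (ZMod p) p) h2
        rwa [map_sub, expand_X, expand_C, ZMod.expand_card] at h3
      have hpow : f * (f ^ (p / 2)) ^ 2 = f ^ p := by
        rw [← pow_mul, ← pow_succ']
        congr 1
        have := hpp.eq_two_or_odd
        omega
      have h4 : X ^ p ∣ f * r 0 ^ 2 - C (f.eval 0) * s 0 ^ 2 := by
        refine ⟨E * (s 0 + X ^ p * A') ^ 2 + C (f.eval 0) * (2 * s 0 * A' + X ^ p * A' ^ 2) -
          f * (2 * r 0 * A + X ^ p * A ^ 2), ?_⟩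
        linear_combination (s 0 + X ^ p * A') ^ 2 * hE + (s 0 + X ^ p * A') ^ 2 * hpow +
          f * (r 0 + X ^ p * A - (s 0 + X ^ p * A') * f ^ (p / 2)) * h1
      have hr0 := hr 0 (by omega)
      have hs0 := hs 0 (by omega)
      have hB0 : ∀ u ∈ degreeLT (ZMod p) B, u = 0 ∨ u.natDegree < B := by
        intro u hu
        rcases eq_or_ne u 0 with h0 | h0
        · exact Or.inl h0
        · rw [mem_degreeLT, degree_eq_natDegree h0, Nat.cast_lt] at hu
          exact Or.inr hu
      refine eq_zero_of_mul_sq_eq_C_mul_sq ha hf0 (sub_eq_zero.1 ?_)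
      have hlt : ∀ u ∈ degreeLT (ZMod p) B, ∀ q : (ZMod p)[X], q.natDegree ≤ f.natDegree →
          q * u ^ 2 ∈ degreeLT (ZMod p) p := by
        intro u hu q hq
        rcases hB0 u hu with rfl | hu
        · simp
        · rw [mem_degreeLT]
          refine degree_le_natDegree.trans_lt ?_
          rw [Nat.cast_lt]
          refine (natDegree_mul_le.trans (add_le_add hq natDegree_pow_le)).trans_lt ?_
          omega
      refine eq_zero_of_dvd_of_degree_lt h4 ?_
      rw [degree_X_pow, ← mem_degreeLT]
      exact Submodule.sub_mem _ (hlt _ hr0 _ le_rfl) (hlt _ hs0 _ (by simp))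
    have h5 : ∑ j ∈ Finset.range J, (r (j + 1) + s (j + 1) * f ^ (p / 2)) * X ^ (p * j) = 0 := by
      rw [hshift fun j => r j + s j * f ^ (p / 2), h00.1, h00.2, zero_mul, add_zero, zero_add,
        mul_eq_zero, or_iff_right hXp] at h
      exact h
    have h6 := ih (fun j => r (j + 1)) (fun j => s (j + 1)) (fun j hj => hr _ (by omega))
      (fun j hj => hs _ (by omega)) h5
    rintro (_ | j) hj
    · exact h00
    · exact h6 j (by omega)

lemma twistedDerivative_pow_sum (f : (ZMod p)[X]) (J : ℕ) (r s : ℕ → (ZMod p)[X])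
    (k : ℕ) :
    (twistedDerivative f 0 ^ k)
        (∑ j ∈ Finset.range J, (r j + s j * f ^ (p / 2)) * X ^ (p * j)) =
      ∑ j ∈ Finset.range J, ((twistedDerivative f 0 ^ k) (r j) +
        (twistedDerivative f ((p / 2 : ℕ) : ZMod p) ^ k) (s j) * f ^ (p / 2)) * X ^ (p * j) := by
  have hpp : p.Prime := Fact.out
  obtain ⟨n, hn⟩ := Nat.exists_eq_add_one_of_ne_zero (n := p / 2)
    (by have := hpp.two_le; omega)
  induction k generalizing r s with
  | zero => simp
  | succ k ih =>
    simp only [pow_succ, Module.End.mul_apply]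
    rw [← ih]
    congr 1
    rw [map_sum]
    refine Finset.sum_congr rfl fun j _ => ?_
    rw [hn]
    simp only [twistedDerivative_apply, derivative_mul, derivative_add, derivative_pow_succ,
      derivative_X_pow, Nat.cast_mul, CharP.cast_eq_zero, C_0]
    push_cast
    simp only [zero_mul, C_0]
    ring

lemma natDegree_sum_mul_X_pow_le (f : (ZMod p)[X]) {B : ℕ} (J : ℕ) (r s : ℕ → (ZMod p)[X])
    (hr : ∀ j ≤ J, (r j).natDegree ≤ B) (hs : ∀ j ≤ J, (s j).natDegree ≤ B) :
    (∑ j ∈ Finset.range (J + 1), (r j + s j * f ^ (p / 2)) * X ^ (p * j)).natDegree ≤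
      B + f.natDegree * (p / 2) + p * J := by
  refine natDegree_sum_le_of_forall_le _ _ fun j hj => ?_
  have hj' : j ≤ J := Nat.lt_succ_iff.1 (Finset.mem_range.1 hj)
  refine natDegree_mul_le.trans (add_le_add ?_ ?_)
  · refine natDegree_add_le_of_degree_le ((hr j hj').trans (Nat.le_add_right _ _)) ?_
    refine natDegree_mul_le.trans (add_le_add (hs j hj') ?_)
    rw [mul_comm]
    exact natDegree_pow_le
  · rw [natDegree_X_pow]
    gcongr

/-- The auxiliary polynomial of Stepanov's method. -/
lemma exists_stepanov_polynomial (hp : p ≠ 2) {f : (ZMod p)[X]} {a : ZMod p}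
    (ha : f.rootMultiplicity a = 1) (hf0 : f.eval 0 ≠ 0) {B K : ℕ}
    (hB : 2 * B + f.natDegree ≤ p) (hK : K * (2 * K * f.natDegree + K + 1) < B) (ε : ZMod p) :
    ∃ R : (ZMod p)[X], R ≠ 0 ∧ R.natDegree ≤ B + f.natDegree * (p / 2) + p * K ∧
      ∀ x, f.eval x ^ (p / 2) = ε → ∀ k < 2 * K,
        ((twistedDerivative f 0 ^ k) R).eval x = 0 := by
  set d := f.natDegree with hd
  set L := B + 2 * K * d + (K + 1) with hL
  let V := degreeLT (ZMod p) B
  let E : ℕ → ((Fin (K + 1) → V) × (Fin (K + 1) → V)) →ₗ[ZMod p] (ZMod p)[X] := fun k =>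
    ∑ j : Fin (K + 1), LinearMap.mulLeft (ZMod p) (X ^ (j : ℕ)) ∘ₗ
      ((twistedDerivative f 0 ^ k) ∘ₗ V.subtype ∘ₗ LinearMap.proj j ∘ₗ LinearMap.fst _ _ _ +
        ε • (twistedDerivative f ((p / 2 : ℕ) : ZMod p) ^ k) ∘ₗ V.subtype ∘ₗ LinearMap.proj j ∘ₗ
          LinearMap.snd _ _ _)
  let Φ : ((Fin (K + 1) → V) × (Fin (K + 1) → V)) →ₗ[ZMod p] (Fin (2 * K) × Fin L → ZMod p) :=
    LinearMap.pi fun q => lcoeff (ZMod p) q.2 ∘ₗ E q.1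
  have : Module.Finite (ZMod p) V := Module.Finite.equiv (degreeLTEquiv (ZMod p) B).symm
  have hV : Module.finrank (ZMod p) V = B := by
    rw [(degreeLTEquiv (ZMod p) B).finrank_eq, Module.finrank_fin_fun]
  have hker : LinearMap.ker Φ ≠ ⊥ := by
    apply LinearMap.ker_ne_bot_of_finrank_lt
    simp only [Module.finrank_prod, Module.finrank_pi_fintype, Module.finrank_self, hV,
      Finset.sum_const, Finset.card_univ, Fintype.card_fin, Fintype.card_prod, smul_eq_mul, mul_one]
    rw [hL]
    nlinarith
  obtain ⟨v, hv, hv0⟩ := (Submodule.ne_bot_iff _).1 hker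
  have hE : ∀ k < 2 * K, E k v = 0 := by
    intro k hk
    have hdeg : E k v ∈ degreeLT (ZMod p) L := by
      simp only [E, LinearMap.sum_apply]
      refine Submodule.sum_mem _ fun j _ => ?_
      have h1 : ∀ c : ZMod p, ∀ u : V, (twistedDerivative f c ^ k) (u : (ZMod p)[X]) ∈
          degreeLT (ZMod p) (B + 2 * K * d) := fun c u =>
        degreeLT_mono (by gcongr) (twistedDerivative_pow_mem_degreeLT f c u.2 k)
      have h2 := Submodule.add_mem _ (h1 0 (v.1 j))
        (Submodule.smul_mem _ ε (h1 ((p / 2 : ℕ) : ZMod p) (v.2 j)))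
      rw [mem_degreeLT] at h2 ⊢
      change (X ^ (j : ℕ) * _ : (ZMod p)[X]).degree < _
      rw [degree_mul, degree_X_pow, hL, add_comm]
      push_cast at h2 ⊢
      refine lt_of_lt_of_le (WithBot.add_lt_add_right (by simp) h2) ?_
      gcongr
      exact_mod_cast j.2.le
    ext i
    rw [coeff_zero]
    rcases lt_or_ge i L with hi | hi
    · exact congrFun (LinearMap.mem_ker.1 hv) (⟨k, hk⟩, ⟨i, hi⟩)
    · exact coeff_eq_zero_of_degree_lt ((mem_degreeLT.1 hdeg).trans_le (by exact_mod_cast hi))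
  let extend : (Fin (K + 1) → V) → ℕ → (ZMod p)[X] := fun u j =>
    if h : j < K + 1 then u ⟨j, h⟩ else 0
  have hext : ∀ (u : Fin (K + 1) → V) (j : Fin (K + 1)), extend u j = u j := by
    intro u j
    exact dif_pos j.2
  have hmem : ∀ u j, extend u j ∈ V := by
    intro u j
    simp only [extend]
    split_ifs
    · exact Subtype.prop _
    · exact V.zero_mem
  have hnat : ∀ u j, (extend u j).natDegree ≤ B := fun u j =>
    natDegree_le_of_degree_le (mem_degreeLT.1 (hmem u j)).le
  refine ⟨∑ j ∈ Finset.range (K + 1), (extend v.1 j + extend v.2 j * f ^ (p / 2)) * X ^ (p * j),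
    ?_, natDegree_sum_mul_X_pow_le f K _ _ (fun _ _ => hnat _ _) (fun _ _ => hnat _ _), ?_⟩
  · intro h0
    have h1 := eq_zero_of_sum_mul_X_pow_eq_zero hp ha hf0 hB (K + 1) _ _
      (fun _ _ => hmem _ _) (fun _ _ => hmem _ _) h0
    refine hv0 (Prod.ext (funext fun j => ?_) (funext fun j => ?_))
    · exact Subtype.ext ((hext v.1 j).symm.trans (h1 j j.2).1)
    · exact Subtype.ext ((hext v.2 j).symm.trans (h1 j j.2).2)
  · intro x hx k hk
    rw [twistedDerivative_pow_sum, Finset.sum_range, eval_finsetSum]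
    have h1 := congrArg (eval x) (hE k hk)
    simp only [E, LinearMap.sum_apply, eval_finsetSum, eval_zero] at h1
    refine Eq.trans ?_ h1
    refine Finset.sum_congr rfl fun j _ => ?_
    rw [hext, hext]
    change _ = eval x (X ^ (j : ℕ) * ((twistedDerivative f 0 ^ k) (v.1 j : (ZMod p)[X]) +
      ε • (twistedDerivative f ((p / 2 : ℕ) : ZMod p) ^ k) (v.2 j : (ZMod p)[X])))
    simp only [eval_mul, eval_add, eval_pow, eval_X, hx, pow_mul, ZMod.pow_card, eval_smul,
      smul_eq_mul]
    ring

lemma card_eval_pow_eq_mul_le (hp : p ≠ 2) {f : (ZMod p)[X]} {a : ZMod p}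
    (ha : f.rootMultiplicity a = 1) (hf0 : f.eval 0 ≠ 0) {B K : ℕ}
    (hB : 2 * B + f.natDegree ≤ p) (hK : K * (2 * K * f.natDegree + K + 1) < B)
    {ε : ZMod p} (hε : ε ≠ 0) :
    (Finset.univ.filter fun x => f.eval x ^ (p / 2) = ε).card * (2 * K) ≤
      B + f.natDegree * (p / 2) + p * K := by
  obtain ⟨R, hR, hdeg, hvan⟩ := exists_stepanov_polynomial hp ha hf0 hB hK ε
  refine le_trans ?_ hdeg
  have hp2 : p / 2 ≠ 0 := by
    have := (Fact.out : p.Prime).two_le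
    omega
  have hdvd : ∏ x ∈ Finset.univ.filter (fun x => f.eval x ^ (p / 2) = ε),
      (X - C x) ^ (2 * K) ∣ R := by
    refine Finset.prod_dvd_of_coprime (fun x _ y _ hxy => ?_) fun x hx => ?_
    · exact (isCoprime_X_sub_C_of_isUnit_sub (sub_ne_zero.2 hxy).isUnit).pow
    · have hx' := (Finset.mem_filter.1 hx).2
      refine X_sub_C_pow_dvd_of_twistedDerivative_pow (p := p) f ?_ ?_ R (hvan x hx')
      · intro h
        rw [h, zero_pow hp2] at hx'
        exact hε hx'.symm
      · nlinarith [Nat.zero_le (K * (2 * K * f.natDegree)), Nat.zero_le (K * K),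
          Nat.zero_le f.natDegree]
  have := natDegree_le_of_dvd hdvd hR
  rw [natDegree_prod_of_monic _ _ fun x _ => (monic_X_sub_C x).pow _] at this
  simpa [natDegree_pow] using this

/-- A Stepanov-type bound for quadratic character sums of polynomials. -/
lemma abs_sum_quadraticChar_eval_mul_le (hp : p ≠ 2) {f : (ZMod p)[X]} {a : ZMod p}
    (ha : f.rootMultiplicity a = 1) (hf0 : f.eval 0 ≠ 0) {B K : ℕ}
    (hB : 2 * B + f.natDegree ≤ p) (hK : K * (2 * K * f.natDegree + K + 1) < B) :
    |∑ x, quadraticChar (ZMod p) (f.eval x)| * (2 * K) ≤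
      2 * (B + f.natDegree * (p / 2 : ℕ)) + 2 * K * f.natDegree := by
  have hring : ringChar (ZMod p) ≠ 2 := by rwa [ZMod.ringChar_zmod_n]
  have hf : f ≠ 0 := by
    rintro rfl
    simp at hf0
  have hcard : ∀ e : ℤ, ((e : ℤ) : ZMod p) ≠ 0 →
      ((Finset.univ.filter fun x => quadraticChar (ZMod p) (f.eval x) = e).card : ℤ) * (2 * K) ≤
        B + f.natDegree * (p / 2 : ℕ) + p * K := by
    intro e he
    have h1 := card_eval_pow_eq_mul_le hp ha hf0 hB hK he
    have h2 : (Finset.univ.filter fun x => quadraticChar (ZMod p) (f.eval x) = e).card ≤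
        (Finset.univ.filter fun x => f.eval x ^ (p / 2) = (e : ZMod p)).card := by
      refine Finset.card_le_card fun x hx => ?_
      simp only [Finset.mem_filter, Finset.mem_univ, true_and] at hx ⊢
      rw [← hx, quadraticChar_eq_pow_of_char_ne_two' hring, ZMod.card]
    exact_mod_cast (Nat.mul_le_mul_right _ h2).trans h1
  have hpos := hcard 1 (by simp)
  have hneg := hcard (-1) (by simp)
  have hzero : (Finset.univ.filter fun x => quadraticChar (ZMod p) (f.eval x) = 0).card ≤
      f.natDegree := by
    refine le_trans (Finset.card_le_card fun x hx => ?_)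
      ((Multiset.toFinset_card_le f.roots).trans (card_roots' f))
    simp only [Finset.mem_filter, Finset.mem_univ, true_and, quadraticChar_eq_zero_iff] at hx
    simpa [hf] using hx
  have hpt : ∀ x, quadraticChar (ZMod p) (f.eval x) = 0 ∨ quadraticChar (ZMod p) (f.eval x) = 1 ∨
      quadraticChar (ZMod p) (f.eval x) = -1 := fun x => quadraticChar_isQuadratic _ _
  have hsum : ∑ x, quadraticChar (ZMod p) (f.eval x) =
      (Finset.univ.filter fun x => quadraticChar (ZMod p) (f.eval x) = 1).card -
      (Finset.univ.filter fun x => quadraticChar (ZMod p) (f.eval x) = -1).card := by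
    simp only [Finset.card_filter]
    push_cast
    rw [← Finset.sum_sub_distrib]
    refine Finset.sum_congr rfl fun x _ => ?_
    rcases hpt x with h | h | h <;> simp [h]
  have htot : (p : ℤ) =
      (Finset.univ.filter fun x => quadraticChar (ZMod p) (f.eval x) = 0).card +
      (Finset.univ.filter fun x => quadraticChar (ZMod p) (f.eval x) = 1).card +
      (Finset.univ.filter fun x => quadraticChar (ZMod p) (f.eval x) = -1).card := by
    simp only [Finset.card_filter]
    push_cast
    rw [← Finset.sum_add_distrib, ← Finset.sum_add_distrib]
    have : ∀ x ∈ (Finset.univ : Finset (ZMod p)),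
        (((if quadraticChar (ZMod p) (f.eval x) = 0 then 1 else 0) +
        if quadraticChar (ZMod p) (f.eval x) = 1 then 1 else 0) +
        if quadraticChar (ZMod p) (f.eval x) = -1 then 1 else 0 : ℤ) = 1 := by
      intro x _
      rcases hpt x with h | h | h <;> simp [h]
    rw [Finset.sum_congr rfl this]
    simp
  have hzero' : (K : ℤ) *
      (Finset.univ.filter fun x => quadraticChar (ZMod p) (f.eval x) = 0).card ≤
      K * f.natDegree := by exact_mod_cast Nat.mul_le_mul_left K hzero
  rw [hsum]
  have h2K : (0 : ℤ) ≤ 2 * K := by positivity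
  rw [← abs_of_nonneg h2K, ← abs_mul, abs_of_nonneg h2K, abs_le]
  constructor <;> nlinarith

/-- If `T` is a set of `D` nonzero residues and `p` is large in terms of `D`, then all `t * (t - x)`
with `t ∈ T` are nonresidues for a suitable `x`. -/
lemma exists_forall_quadraticChar_mul_sub_eq_neg_one (hp : p ≠ 2) (T : Finset (ZMod p))
    (h0 : (0 : ZMod p) ∉ T) (hT : 2 ≤ T.card) (hTp : 128 ^ T.card ≤ p) :
    ∃ x : ZMod p, ∀ t ∈ T, quadraticChar (ZMod p) (t * (t - x)) = -1 := by
  set D := T.card with hD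
  set K := 4 ^ D with hK
  by_contra! hcon
  have hDlt : D < 2 ^ D := Nat.lt_two_pow_self
  have h8 : 4 * D + 5 ≤ 8 ^ D := by
    have h : ∀ n ≥ 2, 4 * n + 5 ≤ 8 ^ n := by
      intro n hn
      induction n, hn using Nat.le_induction with
      | base => norm_num
      | succ n hn ih => rw [pow_succ]; omega
    exact h D hT
  have h16 : K * K = 16 ^ D := by rw [hK, ← mul_pow]; norm_num
  have h128 : (128 : ℕ) ^ D = 8 ^ D * 16 ^ D := by rw [← mul_pow]; norm_num
  have hK4 : K = 2 ^ D * 2 ^ D := by rw [hK, ← mul_pow]; norm_num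
  have hchar : ∀ S ∈ T.powerset, S.Nonempty →
      |∑ x, quadraticChar (ZMod p) (∏ t ∈ S, t * (t - x))| * (2 * K) ≤
        (D + 1) * p + 2 * K * D := by
    intro S hS hne
    have hST := Finset.mem_powerset.1 hS
    obtain ⟨a, haS⟩ := hne
    have hSD : S.card ≤ D := Finset.card_le_card hST
    have hne0 : ∀ t ∈ S, t ≠ 0 := fun t ht h => h0 (h ▸ hST ht)
    set f : (ZMod p)[X] := ∏ t ∈ S, C (-t) * (X - C t) with hf
    have hev : ∀ x, f.eval x = ∏ t ∈ S, t * (t - x) := by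
      intro x
      rw [hf, eval_prod]
      refine Finset.prod_congr rfl fun t _ => ?_
      simp only [eval_mul, eval_C, eval_sub, eval_X]
      ring
    have hdeg : f.natDegree ≤ D := by
      refine (natDegree_prod_le _ _).trans (le_trans ?_ hSD)
      rw [Finset.card_eq_sum_ones]
      refine Finset.sum_le_sum fun t _ => ?_
      exact (natDegree_C_mul_le _ _).trans (natDegree_X_sub_C_le t)
    have hroot : f.rootMultiplicity a = 1 := by
      set g : (ZMod p)[X] := C (-a) * ∏ t ∈ S.erase a, C (-t) * (X - C t) with hg
      have hfg : f = (X - C a) * g := by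
        rw [hf, ← Finset.mul_prod_erase S _ haS, hg]
        ring
      have hga : g.eval a ≠ 0 := by
        rw [hg, eval_mul, eval_C, eval_prod]
        refine mul_ne_zero (neg_ne_zero.2 (hne0 a haS)) (Finset.prod_ne_zero_iff.2 fun t ht => ?_)
        obtain ⟨hta, htS⟩ := Finset.mem_erase.1 ht
        simp only [eval_mul, eval_C, eval_sub, eval_X]
        exact mul_ne_zero (neg_ne_zero.2 (hne0 t htS)) (sub_ne_zero.2 (Ne.symm hta))
      have hg0 : g ≠ 0 := by
        intro h
        simp [h] at hga
      rw [hfg, rootMultiplicity_mul (mul_ne_zero (X_sub_C_ne_zero a) hg0),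
        rootMultiplicity_X_sub_C_self, rootMultiplicity_eq_zero hga]
    have hf0 : f.eval 0 ≠ 0 := by
      rw [hev, Finset.prod_ne_zero_iff]
      intro t ht
      simpa using hne0 t ht
    have hDp : 2 * (K * (2 * K * D + K + 1)) + D + 2 ≤ p := by
      refine le_trans ?_ hTp
      have : K + D + 1 ≤ K * K := by
        have h1 : 4 ^ 2 ≤ K := Nat.pow_le_pow_right (by norm_num) hT
        have h2 : 2 ^ D ≤ K := Nat.pow_le_pow_left (by norm_num) D
        nlinarith
      rw [h128, ← h16]
      nlinarith
    have key := abs_sum_quadraticChar_eval_mul_le hp hroot hf0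
      (B := (p - f.natDegree) / 2) (K := K) (by omega) (by
        have : K * (2 * K * f.natDegree + K + 1) ≤ K * (2 * K * D + K + 1) := by gcongr
        omega)
    simp only [hev] at key
    refine key.trans ?_
    have h1 : 2 * ((p - f.natDegree) / 2 + f.natDegree * (p / 2)) ≤ (D + 1) * p := by
      have h2 : 2 * (p / 2) ≤ p := by omega
      have h3 : 2 * ((p - f.natDegree) / 2) ≤ p := by omega
      nlinarith
    have h4 : 2 * K * f.natDegree ≤ 2 * K * D := by gcongr
    exact_mod_cast add_le_add h1 h4
  have hexp : ∑ x : ZMod p, ∏ t ∈ T, (1 - quadraticChar (ZMod p) (t * (t - x))) =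
      ∑ S ∈ T.powerset, (-1) ^ S.card *
        ∑ x, quadraticChar (ZMod p) (∏ t ∈ S, t * (t - x)) := by
    simp only [sub_eq_add_neg, Finset.prod_one_add]
    rw [Finset.sum_comm]
    refine Finset.sum_congr rfl fun S _ => ?_
    rw [Finset.mul_sum]
    refine Finset.sum_congr rfl fun x _ => ?_
    rw [Finset.prod_neg, map_prod]
  have hupper : ∑ x : ZMod p, ∏ t ∈ T, (1 - quadraticChar (ZMod p) (t * (t - x))) ≤
      D * 2 ^ D := by
    have h1 : ∀ x, x ∉ T → ∏ t ∈ T, (1 - quadraticChar (ZMod p) (t * (t - x))) = 0 := by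
      intro x hx
      obtain ⟨t, ht, htx⟩ := hcon x
      refine Finset.prod_eq_zero ht ?_
      have hne : t * (t - x) ≠ 0 := by
        refine mul_ne_zero (fun h => h0 (h ▸ ht)) (sub_ne_zero.2 fun h => hx (h ▸ ht))
      rcases quadraticChar_dichotomy hne with h | h
      · simp [h]
      · exact absurd h htx
    rw [← Finset.sum_subset (Finset.subset_univ T) fun x _ hx => h1 x hx]
    have h2 : ∀ x ∈ T, ∏ t ∈ T, (1 - quadraticChar (ZMod p) (t * (t - x))) ≤ 2 ^ D := by
      intro x _
      rw [hD, ← Finset.prod_const]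
      refine Finset.prod_le_prod (fun t _ => ?_) fun t _ => ?_ <;>
      rcases quadraticChar_isQuadratic (ZMod p) (t * (t - x)) with h | h | h <;> simp [h]
    simpa using Finset.sum_le_sum h2
  have hlower : (p : ℤ) * (2 * K) - 2 ^ D * ((D + 1) * p + 2 * K * D) ≤
      (∑ x : ZMod p, ∏ t ∈ T, (1 - quadraticChar (ZMod p) (t * (t - x)))) * (2 * K) := by
    rw [hexp, ← Finset.add_sum_erase _ _ (Finset.empty_mem_powerset T), add_mul]
    simp only [Finset.card_empty, pow_zero, Finset.prod_empty, map_one, Finset.sum_const,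
      Finset.card_univ, ZMod.card, one_mul, nsmul_eq_mul, mul_one]
    have h1 : ∀ S ∈ T.powerset.erase ∅, -(((D : ℤ) + 1) * p + 2 * K * D) ≤ (-1) ^ S.card *
        (∑ x, quadraticChar (ZMod p) (∏ t ∈ S, t * (t - x))) * (2 * K) := by
      intro S hS
      obtain ⟨hS0, hS⟩ := Finset.mem_erase.1 hS
      have h2 := hchar S hS (Finset.nonempty_iff_ne_empty.2 hS0)
      refine (neg_le_neg h2).trans ?_
      rw [← neg_mul]
      refine mul_le_mul_of_nonneg_right ?_ (by positivity)
      refine le_trans (le_of_eq ?_) (neg_abs_le _)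
      rw [abs_mul, abs_pow, abs_neg, abs_one, one_pow, one_mul]
    have h3 := Finset.card_nsmul_le_sum _ _ _ h1
    rw [← Finset.sum_mul] at h3
    have h4 : ((T.powerset.erase ∅).card : ℤ) ≤ 2 ^ D := by
      have := Finset.card_le_card (Finset.erase_subset ∅ T.powerset)
      rw [Finset.card_powerset] at this
      exact_mod_cast this
    have h5 : (0 : ℤ) ≤ (D + 1) * p + 2 * K * D := by positivity
    rw [nsmul_eq_mul] at h3
    nlinarith [mul_le_mul_of_nonneg_right h4 h5]
  have hfin : p * (2 * K) ≤ 2 ^ D * ((D + 1) * p + 2 * K * D) + D * 2 ^ D * (2 * K) := by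
    have := hlower.trans (mul_le_mul_of_nonneg_right hupper (by positivity))
    rw [sub_le_iff_le_add'] at this
    exact_mod_cast this
  have h6 : 2 ^ D * (D + 1) ≤ K := by
    rw [hK4]
    gcongr
    omega
  have h7 : p * K ≤ 4 * D * 2 ^ D * K := by nlinarith
  have h9 : p ≤ 4 * D * 2 ^ D := Nat.le_of_mul_le_mul_right h7 (by positivity)
  have h10 : 4 * D * 2 ^ D < 8 ^ D * 16 ^ D :=
    Nat.mul_lt_mul_of_lt_of_le (by omega) (Nat.pow_le_pow_left (by norm_num) D) (by positivity)
  omega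

/-- For large `p` there is a nonzero `c` such that `m * (m - 4 * c)` is a nonresidue for all small
nonzero `m`. -/
lemma exists_forall_not_isSquare (hp : p ≠ 2) {N : ℕ} (hN : 1 ≤ N) (hNp : 128 ^ (2 * N) ≤ p) :
    ∃ c : ZMod p, c ≠ 0 ∧ ∀ m : ℤ, m ≠ 0 → |m| ≤ N → ¬ IsSquare ((m : ZMod p) * (m - 4 * c)) := by
  have hpp : p.Prime := Fact.out
  have h2Np : 2 * N < p := by
    refine lt_of_lt_of_le ?_ hNp
    exact Nat.lt_pow_self (by norm_num)
  set I : Finset ℤ := (Finset.Icc (-N : ℤ) N).erase 0 with hI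
  have hmem : ∀ m : ℤ, m ∈ I ↔ m ≠ 0 ∧ |m| ≤ N := by
    intro m
    rw [hI, Finset.mem_erase, Finset.mem_Icc, abs_le]
  have hinj : Set.InjOn (fun m : ℤ => (m : ZMod p)) I := by
    intro m hm n hn hmn
    rw [Finset.mem_coe, hmem, abs_le] at hm hn
    have h1 : (p : ℤ) ∣ n - m := (ZMod.intCast_eq_intCast_iff_dvd_sub m n p).1 hmn
    have h2 := Int.eq_zero_of_abs_lt_dvd h1 (by rw [abs_lt]; constructor <;> omega)
    omega
  have hcardI : I.card = 2 * N := by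
    rw [hI, Finset.card_erase_of_mem (by simp), Int.card_Icc]
    omega
  have hcard : (I.image fun m : ℤ => (m : ZMod p)).card = 2 * N := by
    rw [Finset.card_image_of_injOn hinj, hcardI]
  have hne : ∀ m ∈ I, (m : ZMod p) ≠ 0 := by
    intro m hm h
    rw [hmem] at hm
    exact hm.1 (Int.eq_zero_of_abs_lt_dvd ((ZMod.intCast_zmod_eq_zero_iff_dvd m p).1 h) (by omega))
  obtain ⟨x, hx⟩ := exists_forall_quadraticChar_mul_sub_eq_neg_one hp
    (I.image fun m : ℤ => (m : ZMod p))
    (by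
      rw [Finset.mem_image]
      rintro ⟨m, hm, h⟩
      exact hne m hm h) (by omega) (by rwa [hcard])
  have h2 : (2 : ZMod p) ≠ 0 := by
    intro h
    have h3 : p ∣ 2 := (ZMod.natCast_eq_zero_iff 2 p).1 (by exact_mod_cast h)
    exact hp ((Nat.prime_dvd_prime_iff_eq hpp Nat.prime_two).1 h3)
  have h4 : (4 : ZMod p) ≠ 0 := by
    rw [show (4 : ZMod p) = 2 * 2 by norm_num]
    exact mul_ne_zero h2 h2
  have hx4 : 4 * (x / 4) = x := mul_div_cancel₀ x h4
  refine ⟨x / 4, ?_, fun m hm0 hmN => ?_⟩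
  · rintro h
    rw [h, mul_zero] at hx4
    have h1 : (1 : ℤ) ∈ I := (hmem 1).2 ⟨one_ne_zero, by simpa using hN⟩
    have := hx _ (Finset.mem_image_of_mem _ h1)
    simp [← hx4] at this
  · rw [hx4, ← quadraticChar_neg_one_iff_not_isSquare]
    exact hx _ (Finset.mem_image_of_mem _ ((hmem m).2 ⟨hm0, hmN⟩))

end

/-- Two points of `x * y = c` whose coordinates differ by `a` and `b` make `ab(ab - 4c)` a
square. -/
lemma isSquare_of_mul_eq_of_add_mul_add_eq {R : Type*} [CommRing R] {x y a b c : R}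
    (h1 : x * y = c) (h2 : (x + a) * (y + b) = c) : IsSquare (a * b * (a * b - 4 * c)) :=
  ⟨b * x - a * y, by linear_combination (4 * a * b + (b * x + a * y - a * b)) * h1
    - (b * x + a * y - a * b) * h2⟩

lemma subsingleton_modularHyperbola_inter_squareBox {p : ℕ} [Fact p.Prime] {c : ZMod p}
    (hc : c ≠ 0) {N : ℕ}
    (h : ∀ m : ℤ, m ≠ 0 → |m| ≤ N → ¬ IsSquare ((m : ZMod p) * (m - 4 * c))) (X Y : ℤ) :
    (ModularHyperbola p (c.val : ℤ) ∩ SquareBox p X Y (Real.sqrt N)).Subsingleton := by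
  have hcv : (((c.val : ℤ) : ℤ) : ZMod p) = c := by simp
  have hsq : ∀ i j : ℤ, 0 ≤ i → (i : ℝ) ≤ Real.sqrt N → 0 ≤ j → (j : ℝ) ≤ Real.sqrt N →
      (j - i) ^ 2 ≤ (N : ℤ) := by
    intro i j hi hi' hj hj'
    have h1 : |((j - i : ℤ) : ℝ)| ≤ Real.sqrt N := by
      have : (0 : ℝ) ≤ i := by exact_mod_cast hi
      have : (0 : ℝ) ≤ j := by exact_mod_cast hj
      push_cast
      rw [abs_le]
      constructor <;> linarith
    have h2 : ((j - i : ℤ) : ℝ) ^ 2 ≤ N := Real.sq_le (Nat.cast_nonneg N) |>.2 (abs_le.1 h1)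
    exact_mod_cast h2
  have hzero : ∀ u v b : ZMod p, u * v = c → u * (v + b) = c → b = 0 := by
    intro u v b h1 h2
    have h3 : u * b = 0 := by linear_combination h2 - h1
    refine (mul_eq_zero.1 h3).resolve_left ?_
    rintro rfl
    exact hc (by rw [← h1, zero_mul])
  have hcast : ∀ {u v : ℤ}, u ≡ v [ZMOD p] → (u : ZMod p) = v :=
    fun {u v} huv => (ZMod.intCast_eq_intCast_iff u v p).2 huv
  have heq : ∀ {u v : ℤ}, 0 ≤ u → u ≤ p - 1 → 0 ≤ v → v ≤ p - 1 → (u : ZMod p) = v → u = v := by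
    intro u v hu hu' hv hv' huv
    have := (ZMod.intCast_eq_intCast_iff u v p).1 huv
    rwa [Int.ModEq, Int.emod_eq_of_lt hu (by omega), Int.emod_eq_of_lt hv (by omega)] at this
  rintro ⟨x₁, y₁⟩ ⟨⟨hx₁, hx₁', hy₁, hy₁', hxy₁⟩, -, -, -, -, i₁, j₁, hi₁, hi₁', hj₁, hj₁', hi, hj⟩
    ⟨x₂, y₂⟩ ⟨⟨hx₂, hx₂', hy₂, hy₂', hxy₂⟩, -, -, -, -, i₂, j₂, hi₂, hi₂', hj₂, hj₂', hi', hj'⟩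
  simp only at *
  have hxy₁ := hcast hxy₁
  have hxy₂ := hcast hxy₂
  have hi := hcast hi
  have hj := hcast hj
  have hi' := hcast hi'
  have hj' := hcast hj'
  have ha := hsq i₁ i₂ hi₁ hi₁' hi₂ hi₂'
  have hb := hsq j₁ j₂ hj₁ hj₁' hj₂ hj₂'
  rw [hcv] at hxy₁ hxy₂
  push_cast at hxy₁ hxy₂ hi hj hi' hj'
  obtain ⟨a, haa⟩ : ∃ a, a = i₂ - i₁ := ⟨_, rfl⟩
  obtain ⟨b, hbb⟩ : ∃ b, b = j₂ - j₁ := ⟨_, rfl⟩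
  rw [← haa] at ha
  rw [← hbb] at hb
  have hxa : (x₂ : ZMod p) = x₁ + a := by
    rw [hi, hi', haa]
    push_cast
    ring
  have hyb : (y₂ : ZMod p) = y₁ + b := by
    rw [hj, hj', hbb]
    push_cast
    ring
  rw [hxa, hyb] at hxy₂
  have hab : a * b = 0 := by
    by_contra hab
    refine h (a * b) hab ?_ ?_
    · rw [abs_le]
      constructor <;> nlinarith [sq_nonneg (a - b), sq_nonneg (a + b)]
    · push_cast
      exact isSquare_of_mul_eq_of_add_mul_add_eq hxy₁ hxy₂
  have hab0 : (a : ZMod p) = 0 ∧ (b : ZMod p) = 0 := by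
    rcases mul_eq_zero.1 hab with h0 | h0
    · rw [h0, Int.cast_zero, add_zero] at hxy₂
      exact ⟨by simp [h0], hzero _ _ _ hxy₁ hxy₂⟩
    · rw [h0, Int.cast_zero, add_zero, mul_comm] at hxy₂
      rw [mul_comm] at hxy₁
      exact ⟨hzero _ _ _ hxy₁ hxy₂, by simp [h0]⟩
  rw [hab0.1, add_zero] at hxa
  rw [hab0.2, add_zero] at hyb
  have hx := heq hx₁ hx₁' hx₂ hx₂' hxa.symm
  have hy := heq hy₁ hy₁' hy₂ hy₂' hyb.symm
  exact Prod.ext hx hy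

/-- There exist infinitely many primes `p ≡ 1 (mod 4)` such that, for some `c` coprime to `p`,
every square of side `√⌊0.1 log p⌋` contains at most one point of `H_p^c`. -/
theorem infinitely_many_primes_with_isolated_points :
    {p : ℕ | p.Prime ∧ p % 4 = 1 ∧ ∃ c : ℤ, Int.gcd c (p : ℤ) = 1 ∧
      ∀ X Y : ℤ, 0 ≤ X → X ≤ (p : ℤ) - 1 → 0 ≤ Y → Y ≤ (p : ℤ) - 1 →
        (ModularHyperbola p c ∩
          SquareBox p X Y (Real.sqrt ((⌊0.1 * Real.log p⌋ : ℤ) : ℝ))).Subsingleton}.Infinite := by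
  rw [Set.infinite_iff_exists_gt]
  intro n
  obtain ⟨p, hpp, hpn, hp1⟩ := Nat.exists_prime_gt_modEq_one (k := 4) (max n ⌈Real.exp 10⌉₊)
    (by norm_num)
  have hp4 : p % 4 = 1 := hp1
  have : Fact p.Prime := ⟨hpp⟩
  have hpexp : Real.exp 10 ≤ p :=
    (Nat.le_ceil _).trans (by exact_mod_cast ((le_max_right _ _).trans_lt hpn).le)
  have hp0 : (0 : ℝ) < p := (Real.exp_pos 10).trans_le hpexp
  have hlog : 10 ≤ Real.log p := (Real.le_log_iff_exp_le hp0).2 hpexp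
  obtain ⟨N, hN⟩ : ∃ N : ℕ, ⌊0.1 * Real.log p⌋ = (N : ℤ) :=
    Int.eq_ofNat_of_zero_le (Int.floor_nonneg.2 (by positivity))
  have hN1 : 1 ≤ N := by
    have : (1 : ℤ) ≤ ⌊0.1 * Real.log p⌋ := Int.le_floor.2 (by push_cast; linarith)
    omega
  have hNlog : (N : ℝ) ≤ 0.1 * Real.log p := by
    have := Int.floor_le (0.1 * Real.log p)
    rw [hN] at this
    exact_mod_cast this
  have hNp : 128 ^ (2 * N) ≤ p := by
    have h1 : (128 : ℝ) ^ (2 * N) ≤ p := by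
      calc (128 : ℝ) ^ (2 * N) = (128 ^ 2) ^ N := by rw [pow_mul]
        _ ≤ (Real.exp 1 ^ 10) ^ N := by
          gcongr
          calc (128 : ℝ) ^ 2 ≤ 2.7 ^ 10 := by norm_num
            _ ≤ Real.exp 1 ^ 10 := by
              gcongr
              linarith [Real.exp_one_gt_d9]
        _ = Real.exp (10 * N) := by
          rw [← pow_mul, ← Real.exp_nat_mul]
          push_cast
          rw [mul_one]
        _ ≤ p := by
          rw [← Real.le_log_iff_exp_le hp0]
          linarith
    exact_mod_cast h1
  obtain ⟨c, hc, hsq⟩ := exists_forall_not_isSquare (p := p) (by omega) hN1 hNp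
  refine ⟨p, ⟨hpp, hp4, c.val, ?_, fun X Y _ _ _ _ => ?_⟩, (le_max_left _ _).trans_lt hpn⟩
  · rw [Int.gcd_natCast_natCast]
    exact ZMod.val_coe_unit_coprime (Units.mk0 c hc)
  · rw [hN]
    exact subsingleton_modularHyperbola_inter_squareBox hc hsq X Y
end

section
/- For every real ε > 0 there exists a constant C_ε > 0 such that for every prime p > 2 and every integer c with gcd(c, p) = 1, there exist a point (x, y) ∈ H_p^c and squarefree positive integers h, k with 1 ≤ h, k ≤ C_ε · p^{1/4} · exp((log p)^{1/2+ε}) such that (x + h)(y + k) ≡ c (mod p). -/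
open Polynomial in
theorem stepanov_independence {p : ℕ} [Fact p.Prime] (hp : Odd p) {f : (ZMod p)[X]} {b : ZMod p}
    (hf0 : f.coeff 0 ≠ 0) (hb : Odd (f.rootMultiplicity b)) {D : ℕ} (hD : 1 ≤ D)
    (hDp : 2 * D + f.natDegree ≤ p) :
    ∀ (J : ℕ) (r s : Fin J → (ZMod p)[X]), (∀ j, (r j).natDegree < D) →
      (∀ j, (s j).natDegree < D) →
      ∑ j, r j * X ^ ((j : ℕ) * p) + f ^ (p / 2) * ∑ j, s j * X ^ ((j : ℕ) * p) = 0 →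
      ∀ j, r j = 0 ∧ s j = 0 := by
  have hfne : f ≠ 0 := by rintro rfl; simp at hf0
  intro J
  induction J with
  | zero => intro r s _ _ _ j; exact j.elim0
  | succ J ih =>
    intro r s hr hs h
    have hsplit : ∀ u : Fin (J + 1) → (ZMod p)[X], ∑ j, u j * X ^ ((j : ℕ) * p) =
        u 0 + (∑ j : Fin J, u j.succ * X ^ ((j : ℕ) * p)) * X ^ p := by
      intro u
      rw [Fin.sum_univ_succ, Finset.sum_mul]
      simp [add_mul, pow_add, mul_assoc]
    rw [hsplit, hsplit] at h
    set A := ∑ j : Fin J, r j.succ * X ^ ((j : ℕ) * p)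
    set B := ∑ j : Fin J, s j.succ * X ^ ((j : ℕ) * p)
    obtain ⟨E, hE⟩ : ∃ E, f ^ p = C (f.coeff 0) + X ^ p * E := by
      refine ⟨expand (ZMod p) p f.divX, ?_⟩
      rw [← ZMod.expand_card]
      have h0 := congrArg (expand (ZMod p) p) f.X_mul_divX_add
      rw [map_add, map_mul, expand_X, expand_C] at h0
      rw [← h0, add_comm]
    have hpow : f ^ p = f * (f ^ (p / 2)) ^ 2 := by
      obtain ⟨n, hn⟩ := hp
      have h2 : p / 2 = n := by omega
      rw [h2, ← pow_mul, ← pow_succ', mul_comm n 2, ← hn]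
    have hdvd : X ^ p ∣ (r 0) ^ 2 * f - C (f.coeff 0) * (s 0) ^ 2 := by
      have h1 : r 0 + A * X ^ p = - (f ^ (p / 2) * (s 0 + B * X ^ p)) := by
        linear_combination h
      have h2 : (r 0 + A * X ^ p) ^ 2 * f = f ^ p * (s 0 + B * X ^ p) ^ 2 := by
        rw [h1, hpow]; ring
      rw [hE] at h2
      refine ⟨E * (s 0 + B * X ^ p) ^ 2 + C (f.coeff 0) * (2 * s 0 * B + B ^ 2 * X ^ p)
        - (2 * r 0 * A + A ^ 2 * X ^ p) * f, ?_⟩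
      linear_combination h2
    have hzero : (r 0) ^ 2 * f - C (f.coeff 0) * (s 0) ^ 2 = 0 := by
      by_contra hne
      have h3 := natDegree_le_of_dvd hdvd hne
      rw [natDegree_X_pow] at h3
      have h4 : ((r 0) ^ 2 * f - C (f.coeff 0) * (s 0) ^ 2).natDegree ≤ 2 * (D - 1) + f.natDegree := by
        have hr0 := hr 0
        have hs0 := hs 0
        refine (natDegree_sub_le _ _).trans (max_le ?_ ?_)
        · refine natDegree_mul_le_of_le (natDegree_pow_le_of_le 2 (by omega)) le_rfl
        · refine (natDegree_C_mul_le _ _).trans ((natDegree_pow_le_of_le 2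
            (show _ ≤ D - 1 by omega)).trans (by omega))
      omega
    have hzero' : (r 0) ^ 2 * f = C (f.coeff 0) * (s 0) ^ 2 := sub_eq_zero.mp hzero
    have hr0 : r 0 = 0 := by
      by_contra hne
      have hl : (r 0) ^ 2 * f ≠ 0 := mul_ne_zero (pow_ne_zero _ hne) hfne
      have hs0 : s 0 ≠ 0 := by
        intro h0; rw [hzero', h0] at hl; simp at hl
      have h5 := congrArg (rootMultiplicity b) hzero'
      rw [rootMultiplicity_mul hl, rootMultiplicity_mul (hzero' ▸ hl), sq, sq,
        rootMultiplicity_mul (mul_ne_zero hne hne), rootMultiplicity_mul (mul_ne_zero hs0 hs0),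
        rootMultiplicity_C] at h5
      obtain ⟨t, ht⟩ := hb
      omega
    have hs0 : s 0 = 0 := by
      rw [hr0] at hzero'
      simpa [hf0] using hzero'.symm
    have hX : (X : (ZMod p)[X]) ^ p ≠ 0 := pow_ne_zero _ X_ne_zero
    have hAB : A + f ^ (p / 2) * B = 0 := by
      apply mul_right_cancel₀ hX
      rw [hr0, hs0] at h
      linear_combination h
    have := ih (fun j => r j.succ) (fun j => s j.succ) (fun j => hr _) (fun j => hs _) hAB
    intro j
    refine Fin.cases ⟨hr0, hs0⟩ (fun j => this j) j

open Polynomial in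
/-- The operator `T k` with `(f ^ N * r)⁽ᵏ⁾ = f ^ (N - k) * T k r`. -/
noncomputable def twistedDeriv {F : Type*} [Field F] (f : F[X]) (N : ℕ) : ℕ → F[X] →ₗ[F] F[X]
  | 0 => LinearMap.id
  | k + 1 => LinearMap.mulLeft F f ∘ₗ derivative ∘ₗ twistedDeriv f N k +
      ((N - k : ℕ) : F) • (LinearMap.mulLeft F (derivative f) ∘ₗ twistedDeriv f N k)

open Polynomial in
theorem iterate_derivative_pow_mul {F : Type*} [Field F] (f r : F[X]) (N : ℕ) :
    ∀ k ≤ N, derivative^[k] (f ^ N * r) = f ^ (N - k) * twistedDeriv f N k r := by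
  intro k
  induction k with
  | zero => intro _; simp [twistedDeriv]
  | succ k ih =>
    intro hk
    rw [Function.iterate_succ_apply', ih (by omega)]
    obtain ⟨n, hn⟩ : ∃ n, N - k = n + 1 := ⟨N - k - 1, by omega⟩
    have hn' : N - (k + 1) = n := by omega
    simp only [twistedDeriv, hn, hn', derivative_mul, derivative_pow, LinearMap.add_apply,
      LinearMap.smul_apply, LinearMap.comp_apply, LinearMap.mulLeft_apply, smul_eq_C_mul,
      Nat.add_sub_cancel]
    ring

open Polynomial in
theorem twistedDeriv_mul_X_pow {p : ℕ} [Fact p.Prime] (f r : (ZMod p)[X]) (N j : ℕ) :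
    ∀ k, twistedDeriv f N k (r * X ^ (j * p)) = twistedDeriv f N k r * X ^ (j * p) := by
  intro k
  induction k with
  | zero => simp [twistedDeriv]
  | succ k ih =>
    have : derivative ((X : (ZMod p)[X]) ^ (j * p)) = 0 := by
      simp [derivative_X_pow]
    simp only [twistedDeriv, LinearMap.add_apply,
      LinearMap.smul_apply, LinearMap.comp_apply, LinearMap.mulLeft_apply, smul_eq_C_mul,
      ih, derivative_mul, this]
    ring

open Polynomial in
theorem natDegree_twistedDeriv_le {F : Type*} [Field F] (f r : F[X]) (N : ℕ) :
    ∀ k, (twistedDeriv f N k r).natDegree ≤ r.natDegree + k * f.natDegree := by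
  intro k
  induction k with
  | zero => simp [twistedDeriv]
  | succ k ih =>
    simp only [twistedDeriv, LinearMap.add_apply,
      LinearMap.smul_apply, LinearMap.comp_apply, LinearMap.mulLeft_apply]
    have h1 := natDegree_derivative_le (twistedDeriv f N k r)
    have h2 := natDegree_derivative_le f
    have h3 : r.natDegree + (k + 1) * f.natDegree =
      f.natDegree + (r.natDegree + k * f.natDegree) := by ring
    rw [h3]
    refine natDegree_add_le_of_degree_le ?_ ?_
    · exact natDegree_mul_le_of_le le_rfl (by omega)
    · refine (natDegree_smul_le _ _).trans (natDegree_mul_le_of_le (by omega) ih)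

open Polynomial in
theorem mul_card_le_natDegree {F : Type*} [Field F] (R : F[X])
    (S : Finset F) (l : ℕ) (h : ∀ x ∈ S, l ≤ R.rootMultiplicity x) : l * S.card ≤ R.natDegree := by
  classical
  calc l * S.card = ∑ x ∈ S, l := by simp [mul_comm]
    _ ≤ ∑ x ∈ S, R.roots.count x := Finset.sum_le_sum fun x hx => by
        rw [count_roots]; exact h x hx
    _ ≤ R.roots.card := by
        rw [← Multiset.toFinset_sum_count_eq]
        refine Finset.sum_le_sum_of_ne_zero fun x _ hx => ?_
        simpa [Multiset.count_eq_zero, and_comm] using hx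
    _ ≤ _ := card_roots' R

open Polynomial in
theorem exists_auxiliary_polynomials {p : ℕ} [Fact p.Prime] (f : (ZMod p)[X]) (a : ZMod p)
    {D J l N N' : ℕ} (hcount : l * (D + l * f.natDegree + J) < 2 * (J * D)) :
    ∃ r s : Fin J → (ZMod p)[X], (∀ j, (r j).natDegree < D) ∧ (∀ j, (s j).natDegree < D) ∧
      (∃ j, ¬ (r j = 0 ∧ s j = 0)) ∧
      ∀ k < l, ∑ j, (twistedDeriv f N k (r j) + C a * twistedDeriv f N' k (s j)) * X ^ (j : ℕ)
        = 0 := by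
  have hD : 1 ≤ D := by
    rcases Nat.eq_zero_or_pos D with h | h
    · simp [h] at hcount
    · exact h
  set E := D + l * f.natDegree + J
  let V := Fin J → degreeLT (ZMod p) D
  let Ψ : ℕ → V × V →ₗ[ZMod p] (ZMod p)[X] := fun k =>
    ∑ j : Fin J, LinearMap.mulRight (ZMod p) (X ^ (j : ℕ)) ∘ₗ
      (twistedDeriv f N k ∘ₗ (degreeLT (ZMod p) D).subtype ∘ₗ LinearMap.proj j ∘ₗ
          LinearMap.fst _ _ _ +
        LinearMap.mulLeft (ZMod p) (C a) ∘ₗ twistedDeriv f N' k ∘ₗ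
          (degreeLT (ZMod p) D).subtype ∘ₗ LinearMap.proj j ∘ₗ LinearMap.snd _ _ _)
  let Φ : V × V →ₗ[ZMod p] (Fin l → Fin E → ZMod p) :=
    LinearMap.pi fun k => LinearMap.pi fun e => lcoeff (ZMod p) e ∘ₗ Ψ k
  have : FiniteDimensional (ZMod p) (degreeLT (ZMod p) D) :=
    (degreeLTEquiv (ZMod p) D).symm.finiteDimensional
  have hrank : Module.finrank (ZMod p) (Fin l → Fin E → ZMod p) <
      Module.finrank (ZMod p) (V × V) := by
    have h1 : Module.finrank (ZMod p) (degreeLT (ZMod p) D) = D := by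
      rw [(degreeLTEquiv (ZMod p) D).finrank_eq]; simp
    have h2 : Module.finrank (ZMod p) V = J * D := by
      simp only [V]
      rw [Module.finrank_pi_fintype]; simp [h1]
    have h3 : Module.finrank (ZMod p) (Fin l → Fin E → ZMod p) = l * E := by
      rw [Module.finrank_pi_fintype]; simp
    rw [h3, Module.finrank_prod, h2]; omega
  obtain ⟨z, hz, hz0⟩ := (Submodule.ne_bot_iff _).mp (LinearMap.ker_ne_bot_of_finrank_lt hrank (f := Φ))
  have hdeg : ∀ u : degreeLT (ZMod p) D, (u : (ZMod p)[X]).natDegree < D := by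
    intro u
    by_cases h0 : (u : (ZMod p)[X]) = 0
    · simp [h0]; omega
    · exact (natDegree_lt_iff_degree_lt h0).mpr (mem_degreeLT.mp u.2)
  refine ⟨fun j => z.1 j, fun j => z.2 j, fun j => hdeg _, fun j => hdeg _, ?_, ?_⟩
  · by_contra! hcon
    apply hz0
    refine Prod.ext (funext fun j => Subtype.ext ?_) (funext fun j => Subtype.ext ?_)
    · exact (hcon j).1
    · exact (hcon j).2
  · intro k hk
    have hΨ : Ψ k z = ∑ j : Fin J, (twistedDeriv f N k (z.1 j) +
        C a * twistedDeriv f N' k (z.2 j)) * X ^ (j : ℕ) := by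
      simp [Ψ]
      rfl
    rw [← hΨ]
    have hlt : (Ψ k z).natDegree < E := by
      rw [hΨ]
      refine lt_of_le_of_lt (natDegree_sum_le_of_forall_le (n := (D - 1 + l * f.natDegree) + J) _ _ ?_)
        (by simp only [E]; omega)
      intro j _
      have hkl : k * f.natDegree ≤ l * f.natDegree := Nat.mul_le_mul_right _ hk.le
      have h1 := hdeg (z.1 j)
      have h2 := hdeg (z.2 j)
      refine natDegree_mul_le_of_le (natDegree_add_le_of_degree_le ?_ ?_)
        ((natDegree_X_pow_le _).trans j.2.le)
      · exact (natDegree_twistedDeriv_le _ _ _ _).trans (by omega)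
      · exact (natDegree_C_mul_le _ _).trans ((natDegree_twistedDeriv_le _ _ _ _).trans (by omega))
    ext e
    by_cases he : e < E
    · exact congrFun (congrFun (LinearMap.mem_ker.mp hz) ⟨k, hk⟩) ⟨e, he⟩
    · rw [coeff_eq_zero_of_natDegree_lt (by omega), coeff_zero]

open Polynomial in
theorem stepanov_count {p : ℕ} [Fact p.Prime] (hp : Odd p) {f : (ZMod p)[X]} {b : ZMod p}
    (hf0 : f.coeff 0 ≠ 0) (hb : Odd (f.rootMultiplicity b)) (a : ZMod p) {D J l : ℕ}
    (hl : 1 ≤ l) (hlp : l ≤ p)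
    (hDp : 2 * D + f.natDegree ≤ p) (hcount : l * (D + l * f.natDegree + J) < 2 * (J * D))
    (S : Finset (ZMod p)) (hS : ∀ x ∈ S, (f.eval x) ^ (p / 2) = a) :
    l * S.card ≤ l * f.natDegree + (p / 2) * f.natDegree + D + J * p := by
  obtain ⟨r, s, hr, hs, ⟨j₀, hj₀⟩, hrs⟩ :=
    exists_auxiliary_polynomials f a (N := l) (N' := l + p / 2) hcount
  have hfne : f ≠ 0 := by rintro rfl; simp at hf0
  have hD : 1 ≤ D := by have := hr j₀; omega
  set A := ∑ j, r j * X ^ ((j : ℕ) * p) with hA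
  set B := ∑ j, s j * X ^ ((j : ℕ) * p) with hB
  set R := f ^ l * A + f ^ (l + p / 2) * B with hR
  have hR0 : R ≠ 0 := by
    intro h0
    apply hj₀
    refine stepanov_independence hp hf0 hb hD hDp J r s hr hs ?_ j₀
    apply mul_left_cancel₀ (pow_ne_zero l hfne)
    rw [mul_zero, ← h0, hR, pow_add]
    ring
  have hdeg : ∀ u : Fin J → (ZMod p)[X], (∀ j, (u j).natDegree < D) →
      (∑ j, u j * X ^ ((j : ℕ) * p)).natDegree ≤ D + J * p := by
    intro u hu
    refine natDegree_sum_le_of_forall_le _ _ fun j _ => ?_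
    exact natDegree_mul_le_of_le (hu j).le
      ((natDegree_X_pow_le _).trans (Nat.mul_le_mul_right _ j.2.le))
  have hRdeg : R.natDegree ≤ l * f.natDegree + (p / 2) * f.natDegree + D + J * p := by
    refine natDegree_add_le_of_degree_le ?_ ?_
    · exact (natDegree_mul_le_of_le (natDegree_pow_le) (hdeg r hr)).trans (by omega)
    · exact (natDegree_mul_le_of_le (natDegree_pow_le) (hdeg s hs)).trans (by rw [add_mul]; omega)
  refine (mul_card_le_natDegree R S l fun x hx => ?_).trans hRdeg
  obtain ⟨l, rfl⟩ : ∃ n, l = n + 1 := ⟨l - 1, by omega⟩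
  rw [Nat.succ_le_iff, lt_rootMultiplicity_iff_isRoot_iterate_derivative_of_mem_nonZeroDivisors hR0]
  · intro k hk
    have hT : ∀ (N : ℕ) (u : Fin J → (ZMod p)[X]),
        (twistedDeriv f N k (∑ j, u j * X ^ ((j : ℕ) * p))).eval x =
          ∑ j, (twistedDeriv f N k (u j)).eval x * x ^ (j : ℕ) := by
      intro N u
      rw [map_sum, eval_finsetSum]
      refine Finset.sum_congr rfl fun j _ => ?_
      rw [twistedDeriv_mul_X_pow, eval_mul, eval_pow, eval_X, mul_comm (j : ℕ) p, pow_mul,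
        ZMod.pow_card]
    have h0 := congrArg (eval x) (hrs k (by omega))
    rw [eval_finsetSum, eval_zero] at h0
    simp only [eval_mul, eval_add, eval_C, eval_pow, eval_X, add_mul, mul_assoc,
      Finset.sum_add_distrib, ← Finset.mul_sum] at h0
    have hexp : l + 1 + p / 2 - k = (l + 1 - k) + p / 2 := by omega
    rw [IsRoot.def, hR, iterate_map_add, iterate_derivative_pow_mul _ _ _ _ (by omega),
      iterate_derivative_pow_mul _ _ _ _ (by omega), hexp, hA, hB]
    simp only [eval_add, eval_mul, eval_pow, hT, pow_add, hS x hx]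
    linear_combination (eval x f) ^ (l + 1 - k) * h0
  · rw [mem_nonZeroDivisors_iff_ne_zero, Ne, ZMod.natCast_eq_zero_iff,
      (Fact.out : p.Prime).dvd_factorial]
    omega

open Polynomial in
theorem stepanov_count_of_sq_le {p : ℕ} [Fact p.Prime] (hp : Odd p) {f : (ZMod p)[X]} {b : ZMod p}
    (hf0 : f.coeff 0 ≠ 0) (hb : Odd (f.rootMultiplicity b)) (a : ZMod p) {t : ℕ} (ht : 1 ≤ t)
    (htp : 16 * t ^ 2 ≤ p) (hm : 4 * f.natDegree ≤ p)
    (S : Finset (ZMod p)) (hS : ∀ x ∈ S, (f.eval x) ^ (p / 2) = a) :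
    4 * t * S.card ≤ 2 * t * p + 4 * t * f.natDegree + 4 * f.natDegree * p := by
  have hfne : f ≠ 0 := by rintro rfl; simp at hf0
  have hm1 : 1 ≤ f.natDegree := by
    by_contra h
    have h0 : f.natDegree = 0 := by omega
    rw [natDegree_eq_zero] at h0
    obtain ⟨x, rfl⟩ := h0
    simp at hb
  obtain ⟨D, hD⟩ : ∃ D, D = (p - f.natDegree) / 2 := ⟨_, rfl⟩
  have hD1 : 2 * D + f.natDegree ≤ p := by omega
  have hD2 : p ≤ 2 * D + f.natDegree + 1 := by omega
  set m := f.natDegree with hmdef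
  have hcount : 2 * t * (D + 2 * t * m + (t + m)) < 2 * ((t + m) * D) := by
    have h1 : 16 * t ^ 2 * m ≤ p * m := Nat.mul_le_mul_right _ htp
    have h2 : m * p ≤ m * (2 * D + m + 1) := Nat.mul_le_mul_left _ hD2
    have h3 : m * (4 * m) ≤ m * p := Nat.mul_le_mul_left _ hm
    have h4 : t * m ≤ t ^ 2 * m := Nat.mul_le_mul_right _ (Nat.le_self_pow two_ne_zero t)
    have h5 : 16 * m ≤ p * m := Nat.mul_le_mul_right _ (by nlinarith)
    have h6 : t ^ 2 * 1 ≤ t ^ 2 * m := Nat.mul_le_mul_left _ hm1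
    nlinarith
  have hlp : 2 * t ≤ p := by nlinarith
  have h := stepanov_count hp hf0 hb a (by omega : 1 ≤ 2 * t) hlp hD1 hcount S hS
  have h2 : 2 * (p / 2) ≤ p := by omega
  have h3 : 2 * (p / 2) * m ≤ p * m := Nat.mul_le_mul_right _ h2
  have h4 : p * 1 ≤ p * m := Nat.mul_le_mul_left _ hm1
  rw [← hmdef] at h
  nlinarith

open Polynomial in
/-- A Weil-type bound for the quadratic character, obtained by Stepanov's method. -/
theorem abs_sum_quadraticChar_eval_le {p : ℕ} [Fact p.Prime] (hp : Odd p) {f : (ZMod p)[X]}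
    {b : ZMod p} (hf0 : f.coeff 0 ≠ 0) (hb : Odd (f.rootMultiplicity b)) {t : ℕ} (ht : 1 ≤ t)
    (htp : 16 * t ^ 2 ≤ p) (hm : 4 * f.natDegree ≤ p) :
    (t : ℤ) * |∑ x, quadraticChar (ZMod p) (f.eval x)| ≤ 3 * f.natDegree * p := by
  classical
  have hfne : f ≠ 0 := by rintro rfl; simp at hf0
  have hchar : ringChar (ZMod p) ≠ 2 := by
    rw [ZMod.ringChar_zmod_n]; rintro rfl; exact absurd hp (by decide)
  have hpow : ∀ y : ZMod p, (quadraticChar (ZMod p) y : ZMod p) = y ^ (p / 2) := by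
    intro y
    have := quadraticChar_eq_pow_of_char_ne_two' hchar y
    rwa [ZMod.card] at this
  set χ := quadraticChar (ZMod p)
  set S : ℤ → Finset (ZMod p) := fun a => Finset.univ.filter fun x => χ (f.eval x) = a with hSdef
  have hcount : ∀ a : ℤ, 4 * (t : ℤ) * (S a).card ≤
      2 * t * p + 4 * t * f.natDegree + 4 * f.natDegree * p := by
    intro a
    exact_mod_cast stepanov_count_of_sq_le hp hf0 hb (a : ZMod p) ht htp hm (S a) (by
      intro x hx
      rw [← hpow, (Finset.mem_filter.mp hx).2])
  have hZ : (S 0).card ≤ f.natDegree := by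
    refine le_trans (Finset.card_le_card ?_) (card_roots' f |> f.roots.toFinset_card_le.trans)
    intro x hx
    have h0 := (Finset.mem_filter.mp hx).2
    rw [quadraticChar_eq_zero_iff] at h0
    simpa [hfne] using h0
  have hcard : ∀ a, ((S a).card : ℤ) = ∑ x, if χ (f.eval x) = a then 1 else 0 := by
    intro a; simp [S]
  have hcardp : (p : ℤ) = ∑ x : ZMod p, 1 := by simp [ZMod.card]
  have hval : ∀ y, χ y = 0 ∨ χ y = 1 ∨ χ y = -1 := by
    intro y
    by_cases h : y = 0
    · left; simp [χ, h]
    · right; exact quadraticChar_dichotomy h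
  have h1 : ∑ x, χ (f.eval x) = 2 * (S 1).card - p + (S 0).card := by
    rw [hcard, hcard, hcardp, Finset.mul_sum, ← Finset.sum_sub_distrib, ← Finset.sum_add_distrib]
    refine Finset.sum_congr rfl fun x _ => ?_
    rcases hval (f.eval x) with h | h | h <;> simp [h]
  have h2 : ∑ x, χ (f.eval x) = p - 2 * (S (-1)).card - (S 0).card := by
    rw [hcard, hcard, hcardp, Finset.mul_sum, ← Finset.sum_sub_distrib, ← Finset.sum_sub_distrib]
    refine Finset.sum_congr rfl fun x _ => ?_
    rcases hval (f.eval x) with h | h | h <;> simp [h]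
  have hZ' : ((S 0).card : ℤ) ≤ f.natDegree := by exact_mod_cast hZ
  have c1 := hcount 1
  have c2 := hcount (-1)
  have htZ : (t : ℤ) * (S 0).card ≤ t * f.natDegree := by gcongr
  have htm : 3 * (t : ℤ) * f.natDegree ≤ p * f.natDegree := by
    have : 3 * (t : ℤ) ≤ p := by exact_mod_cast (by nlinarith : 3 * t ≤ p)
    gcongr
  rw [← abs_of_nonneg (Int.natCast_nonneg t), ← abs_mul, abs_le]
  constructor
  · rw [h2]; nlinarith
  · rw [h1]; nlinarith

open Polynomial in
theorem odd_rootMultiplicity_prod_one_sub {F : Type*} [Field F] {S : Finset F} {b : F}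
    (hb : b ∈ S) (hb0 : b ≠ 0) :
    Odd ((∏ c ∈ S, (1 - C c * X)).rootMultiplicity b⁻¹) := by
  classical
  have hne : ∀ c : F, (1 - C c * X : F[X]) ≠ 0 := by
    intro c h
    have := congrArg (eval 0) h
    simp at this
  have hlin : (1 - C b * X : F[X]) = C (-b) * (X - C b⁻¹) := by
    rw [mul_sub, ← C_mul]; simp [hb0]; ring
  rw [← Finset.mul_prod_erase S _ hb, rootMultiplicity_mul
    (mul_ne_zero (hne b) (Finset.prod_ne_zero_iff.mpr fun c _ => hne c))]
  have h1 : rootMultiplicity b⁻¹ (1 - C b * X : F[X]) = 1 := by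
    have h0 := hne b
    rw [hlin] at h0 ⊢
    rw [rootMultiplicity_mul h0, rootMultiplicity_C, rootMultiplicity_X_sub_C_self]
  have h2 : rootMultiplicity b⁻¹ (∏ c ∈ S.erase b, (1 - C c * X : F[X])) = 0 := by
    apply rootMultiplicity_eq_zero
    rw [IsRoot.def, eval_prod, Finset.prod_eq_zero_iff]
    rintro ⟨c, hc, h0⟩
    simp only [eval_sub, eval_one, eval_mul, eval_C, eval_X] at h0
    apply (Finset.mem_erase.mp hc).1
    field_simp at h0
    rw [mul_zero] at h0
    exact (sub_eq_zero.mp h0).symm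
  rw [h1, h2]
  exact odd_one

open Polynomial in
/-- The numbers `x` for which all the linear forms `1 - b * x` are non-residues are rare. -/
theorem card_forall_quadraticChar_eq_neg_one_le {p : ℕ} [Fact p.Prime] (hp : Odd p)
    {W : Finset (ZMod p)} (hW : ∀ b ∈ W, b ≠ 0) {t : ℕ} (ht : 1 ≤ t)
    (htp : 16 * t ^ 2 ≤ p) (hm : 4 * W.card ≤ p) (A : Finset (ZMod p))
    (hA : ∀ x ∈ A, ∀ b ∈ W, quadraticChar (ZMod p) (1 - b * x) = -1) :
    t * (2 ^ W.card * A.card) ≤ t * p + 2 ^ W.card * (3 * W.card * p) := by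
  classical
  set χ := quadraticChar (ZMod p)
  have hχ : ∀ y, 0 ≤ 1 + -χ y := by
    intro y
    by_cases h : y = 0
    · simp [χ, h]
    · rcases quadraticChar_dichotomy h with h | h <;> simp [χ, h]
  have hlow : ((2 ^ W.card * A.card : ℕ) : ℤ) ≤ ∑ x, ∏ b ∈ W, (1 + -χ (1 - b * x)) := by
    calc ((2 ^ W.card * A.card : ℕ) : ℤ) = ∑ x ∈ A, ∏ b ∈ W, (1 + -χ (1 - b * x)) := by
          rw [Finset.sum_congr rfl (g := fun _ => (2 : ℤ) ^ W.card)]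
          · simp [mul_comm]
          · intro x hx
            rw [Finset.prod_congr rfl (g := fun _ => (2 : ℤ))]
            · simp
            · intro b hb
              rw [hA x hx b hb]; norm_num
      _ ≤ _ := Finset.sum_le_sum_of_subset_of_nonneg (Finset.subset_univ _)
          fun x _ _ => Finset.prod_nonneg fun b _ => hχ _
  have hswap : ∑ x, ∏ b ∈ W, (1 + -χ (1 - b * x)) =
      ∑ S ∈ W.powerset, ∑ x, ∏ b ∈ S, -χ (1 - b * x) := by
    rw [Finset.sum_comm]
    exact Finset.sum_congr rfl fun x _ => Finset.prod_one_add W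
  have hterm : ∀ S ∈ W.powerset,
      (t : ℤ) * ∑ x, ∏ b ∈ S, -χ (1 - b * x) ≤ (if S = ∅ then (t : ℤ) * p else 0)
        + 3 * W.card * p := by
    intro S hS
    have hSW := Finset.mem_powerset.mp hS
    rcases S.eq_empty_or_nonempty with rfl | ⟨b, hb⟩
    · simp [ZMod.card]
      positivity
    · rw [if_neg (Finset.ne_empty_of_mem hb), zero_add]
      set f : (ZMod p)[X] := ∏ c ∈ S, (1 - C c * X)
      have hdeg : f.natDegree ≤ W.card := by
        refine (natDegree_prod_le _ _).trans ((Finset.sum_le_card_nsmul S _ 1 fun c _ => ?_).trans ?_)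
        · refine (natDegree_sub_le _ _).trans (max_le (by simp) ?_)
          exact (natDegree_C_mul_le _ _).trans natDegree_X_le
        · simpa using Finset.card_le_card hSW
      have hf0 : f.coeff 0 ≠ 0 := by
        rw [coeff_zero_eq_eval_zero, eval_prod]; simp
      have hbound := abs_sum_quadraticChar_eval_le hp hf0
        (odd_rootMultiplicity_prod_one_sub hb (hW b (hSW hb))) ht htp (by omega)
      have heq : ∑ x, ∏ b ∈ S, -χ (1 - b * x) = (-1) ^ S.card * ∑ x, χ (f.eval x) := by
        rw [Finset.mul_sum]
        refine Finset.sum_congr rfl fun x _ => ?_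
        rw [eval_prod, map_prod, Finset.prod_neg]
        simp
      rw [heq]
      calc (t : ℤ) * ((-1) ^ S.card * ∑ x, χ (f.eval x))
          ≤ t * |(-1) ^ S.card * ∑ x, χ (f.eval x)| := by gcongr; exact le_abs_self _
        _ = t * |∑ x, χ (f.eval x)| := by rw [abs_mul, abs_pow]; simp
        _ ≤ 3 * f.natDegree * p := hbound
        _ ≤ 3 * W.card * p := by gcongr
  have hfin : (t : ℤ) * (2 ^ W.card * A.card : ℕ) ≤ t * p + 2 ^ W.card * (3 * W.card * p) := by
    calc (t : ℤ) * (2 ^ W.card * A.card : ℕ)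
        ≤ t * ∑ S ∈ W.powerset, ∑ x, ∏ b ∈ S, -χ (1 - b * x) := by
          rw [← hswap]; gcongr
      _ ≤ ∑ S ∈ W.powerset, ((if S = ∅ then (t : ℤ) * p else 0) + 3 * W.card * p) := by
          rw [Finset.mul_sum]; exact Finset.sum_le_sum hterm
      _ = _ := by
          rw [Finset.sum_add_distrib, Finset.sum_ite_eq' , if_pos (Finset.empty_mem_powerset W)]
          simp
  exact_mod_cast hfin

theorem exists_quadraticChar_ne_neg_one {p : ℕ} [Fact p.Prime] (hp : Odd p) {a : ZMod p}
    (ha : a ≠ 0) {V P Q : Finset ℕ} (hV : ∀ v ∈ V, v.Prime ∧ v < p)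
    (hP : ∀ h ∈ P, h.Prime) (hQ : ∀ k ∈ Q, k.Prime) (hPQ : Disjoint P Q)
    (hlt : ∀ h ∈ P, ∀ k ∈ Q, h * k < p) {t : ℕ} (ht : 1 ≤ t)
    (htp : 16 * t ^ 2 ≤ p) (hm : 4 * V.card ≤ p)
    (hcard : t * p + 2 ^ V.card * (3 * V.card * p) < t * (2 ^ V.card * (P.card * Q.card))) :
    ∃ v ∈ V, ∃ h ∈ P, ∃ k ∈ Q,
      quadraticChar (ZMod p) (1 - a / ((h * v * k : ℕ) : ZMod p)) ≠ -1 := by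
  classical
  by_contra! hcon
  have hcast : ∀ {m n : ℕ}, m < p → n < p → (m : ZMod p) = n → m = n := by
    intro m n hm hn h
    rw [ZMod.natCast_eq_natCast_iff'] at h
    rwa [Nat.mod_eq_of_lt hm, Nat.mod_eq_of_lt hn] at h
  set W : Finset (ZMod p) := V.image fun v : ℕ => (v : ZMod p)⁻¹
  have hWcard : W.card = V.card := by
    refine Finset.card_image_of_injOn fun v hv v' hv' h => ?_
    exact hcast (hV v hv).2 (hV v' hv').2 (inv_injective h)
  set A : Finset (ZMod p) := (P ×ˢ Q).image fun u => a / ((u.1 * u.2 : ℕ) : ZMod p)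
  have hAcard : A.card = P.card * Q.card := by
    rw [← Finset.card_product]
    refine Finset.card_image_of_injOn ?_
    rintro ⟨h, k⟩ hu ⟨h', k'⟩ hu' heq
    simp only [Finset.coe_product, Set.mem_prod, Finset.mem_coe] at hu hu'
    have h1 : h * k = h' * k' := by
      apply hcast (hlt h hu.1 k hu.2) (hlt h' hu'.1 k' hu'.2)
      simp only [div_eq_mul_inv] at heq
      exact inv_injective (mul_left_cancel₀ ha heq)
    have h2 : h ∣ h' * k' := h1 ▸ Dvd.intro k rfl
    have hh : h = h' := by
      rcases (hP h hu.1).dvd_mul.mp h2 with h3 | h3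
      · exact (Nat.prime_dvd_prime_iff_eq (hP h hu.1) (hP h' hu'.1)).mp h3
      · have := (Nat.prime_dvd_prime_iff_eq (hP h hu.1) (hQ k' hu'.2)).mp h3
        exact absurd rfl (Finset.disjoint_iff_ne.mp hPQ h hu.1 h (this ▸ hu'.2))
    subst hh
    rw [Nat.mul_right_inj (hP h hu.1).ne_zero] at h1
    rw [h1]
  have hbound := card_forall_quadraticChar_eq_neg_one_le hp (W := W) (by
    intro b hb
    obtain ⟨v, hv, rfl⟩ := Finset.mem_image.mp hb
    rw [Ne, inv_eq_zero, ZMod.natCast_eq_zero_iff]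
    exact Nat.not_dvd_of_pos_of_lt (hV v hv).1.pos (hV v hv).2) ht htp (by rwa [hWcard]) A (by
    intro x hx b hb
    obtain ⟨v, hv, rfl⟩ := Finset.mem_image.mp hb
    obtain ⟨⟨h, k⟩, hu, rfl⟩ := Finset.mem_image.mp hx
    rw [Finset.mem_product] at hu
    rw [← hcon v hv h hu.1 k hu.2]
    congr 2
    push_cast
    simp only [div_eq_mul_inv, mul_inv]
    ring)
  rw [hWcard, hAcard] at hbound
  omega

theorem exists_hyperbola_points {p : ℕ} [Fact p.Prime] (hp : Odd p) {c : ℤ}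
    (hc : (c : ZMod p) ≠ 0) {h k : ℕ} (hk : (k : ZMod p) ≠ 0) (hh : (h : ZMod p) ≠ 0)
    (hχ : quadraticChar (ZMod p) (1 - 4 * c / ((h * k : ℕ) : ZMod p)) ≠ -1) :
    ∃ x y : ℤ, (x, y) ∈ ModularHyperbola p c ∧
      (x + (h : ℤ)) * (y + (k : ℤ)) ≡ c [ZMOD (p : ℤ)] := by
  have h2 : NeZero (2 : ZMod p) := ⟨by
    intro h0
    have h1 : ((2 : ℕ) : ZMod p) = 0 := by exact_mod_cast h0
    rw [ZMod.natCast_eq_zero_iff] at h1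
    have := Nat.le_of_dvd two_pos h1
    have := (Fact.out : p.Prime).two_le
    have h3 : p = 2 := by omega
    subst h3
    exact absurd hp (by decide)⟩
  have hsq : IsSquare (1 - 4 * c / ((h * k : ℕ) : ZMod p)) := by
    by_contra hns
    exact hχ (quadraticChar_neg_one_iff_not_isSquare.mpr hns)
  obtain ⟨s, hs⟩ := hsq
  obtain ⟨x, hx⟩ := exists_quadratic_eq_zero (a := (k : ZMod p)) (b := h * k) (c := h * c) hk
    ⟨h * k * s, by
      have h3 : (h * k : ZMod p) ^ 2 * (1 - 4 * c / ((h * k : ℕ) : ZMod p)) =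
        (h * k : ZMod p) ^ 2 * (s * s) := by rw [hs]
      push_cast at h3
      rw [discrim]
      have h4 : (h * k : ZMod p) ^ 2 * (1 - 4 * c / (h * k : ZMod p)) =
          (h * k : ZMod p) ^ 2 - 4 * k * (h * c) := by field_simp
      rw [← h4, h3]; ring⟩
  have hx0 : x ≠ 0 := by
    rintro rfl
    simp at hx
    tauto
  have hp1 : ∀ z : ZMod p, 0 ≤ (z.val : ℤ) ∧ (z.val : ℤ) ≤ (p : ℤ) - 1 := by
    intro z
    have := ZMod.val_lt z
    omega
  refine ⟨x.val, ((c : ZMod p) / x).val,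
    ⟨(hp1 _).1, (hp1 _).2, (hp1 _).1, (hp1 _).2, ?_⟩, ?_⟩
  · rw [← ZMod.intCast_eq_intCast_iff]
    push_cast
    rw [ZMod.natCast_zmod_val, ZMod.natCast_zmod_val]
    field_simp
  · rw [← ZMod.intCast_eq_intCast_iff]
    push_cast
    rw [ZMod.natCast_zmod_val, ZMod.natCast_zmod_val]
    field_simp
    linear_combination hx

theorem natCast_four_ne_zero {p : ℕ} [Fact p.Prime] (hp : Odd p) : ((4 : ℕ) : ZMod p) ≠ 0 := by
  intro h
  rw [ZMod.natCast_eq_zero_iff, (by norm_num : 4 = 2 ^ 2)] at h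
  have := (Nat.prime_dvd_prime_iff_eq Fact.out Nat.prime_two).mp
    ((Fact.out : p.Prime).dvd_of_dvd_pow h)
  subst this
  exact absurd hp (by decide)

theorem exists_squarefree_natCast_eq_four_mul {p : ℕ} [Fact p.Prime] (hp : Odd p) (c : ZMod p)
    (hc : c ≠ 0) : ∃ h : ℕ, 1 ≤ h ∧ Squarefree h ∧ (h : ZMod p) = 4 * c := by
  have h4 : (4 * c : ZMod p) ≠ 0 :=
    mul_ne_zero (by exact_mod_cast natCast_four_ne_zero hp) hc
  obtain ⟨q, hq, hqc⟩ := (Nat.infinite_setOfPred_prime_and_eq_mod h4.isUnit).nonempty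
  exact ⟨q, hq.one_le, hq.squarefree, hqc⟩

theorem div_two_le_primeCounting_mul_log {N : ℕ} (hN : 15 ≤ N) :
    (N : ℝ) / 2 ≤ N.primeCounting * Real.log N := by
  have h1 := Chebyshev.pi_ge N
  have hN' : (15 : ℝ) ≤ N := by exact_mod_cast hN
  have hlog : 0 < Real.log N := Real.log_pos (by linarith)
  rw [div_le_iff₀ hlog] at h1
  have h2 : Real.log (N + 1) ≤ (N + 1) / 16 - 1 + 4 * Real.log 2 := by
    have h3 := Real.log_le_sub_one_of_pos (show (0 : ℝ) < (N + 1) / 16 by positivity)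
    rw [Real.log_div (by positivity) (by norm_num), show (16 : ℝ) = 2 ^ 4 by norm_num,
      Real.log_pow] at h3
    push_cast at h3
    linarith
  have h4 := Real.log_two_gt_d9
  have h5 := Real.log_two_lt_d9
  nlinarith

theorem exists_prime_finsets {w H : ℕ} (hw : 6 ≤ w) {n : ℕ} (hH : w + 2 * n ≤ H.primeCounting) :
    ∃ V P Q : Finset ℕ, V.card = w ∧ P.card = n ∧ Q.card = n ∧ Disjoint P Q ∧ Disjoint P V ∧
      (∀ v ∈ V, v.Prime ∧ v ≤ w ^ 3) ∧ (∀ h ∈ P, h.Prime ∧ h ≤ H) ∧ ∀ k ∈ Q, k.Prime ∧ k ≤ H := by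
  have hV : w ≤ (w ^ 3).primeCounting := by
    have h1 := div_two_le_primeCounting_mul_log (N := w ^ 3)
      ((by norm_num : 15 ≤ 6 ^ 3).trans (Nat.pow_le_pow_left hw 3))
    have hw' : (6 : ℝ) ≤ w := by exact_mod_cast hw
    have h2 : Real.log w ≤ w := Real.log_le_self (by positivity)
    push_cast at h1
    rw [Real.log_pow] at h1
    push_cast at h1
    have h3 : (0 : ℝ) ≤ (w ^ 3).primeCounting := by positivity
    have h4 : ((w ^ 3).primeCounting : ℝ) * (3 * Real.log w) ≤ (w ^ 3).primeCounting * (3 * w) := by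
      gcongr
    have h5 : (w : ℝ) * w ≤ (w ^ 3).primeCounting * 6 := by
      have : (w : ℝ) * (w * w) ≤ w * ((w ^ 3).primeCounting * 6) := by nlinarith
      exact le_of_mul_le_mul_left this (by positivity)
    have h6 : (w : ℝ) ≤ (w ^ 3).primeCounting := by nlinarith
    exact_mod_cast h6
  have hmem : ∀ {N q : ℕ}, q ∈ Nat.primesLE N → q.Prime ∧ q ≤ N := by
    intro N q hq
    rw [Nat.mem_primesLE] at hq
    exact hq.symm
  rw [← Nat.primesLE_card_eq_primeCounting] at hV hH
  obtain ⟨V, hVs, hVc⟩ := Finset.exists_subset_card_eq hV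
  obtain ⟨P, hPs, hPc⟩ := Finset.exists_subset_card_eq (n := n) (s := Nat.primesLE H \ V) (by
    have := Finset.le_card_sdiff V (Nat.primesLE H)
    omega)
  obtain ⟨Q, hQs, hQc⟩ := Finset.exists_subset_card_eq (n := n) (s := (Nat.primesLE H \ V) \ P) (by
    have := Finset.le_card_sdiff V (Nat.primesLE H)
    have := Finset.le_card_sdiff P (Nat.primesLE H \ V)
    omega)
  refine ⟨V, P, Q, hVc, hPc, hQc, ?_, ?_, fun v hv => hmem (hVs hv), fun h hh => ?_, fun k hk => ?_⟩
  · exact (Finset.disjoint_sdiff).mono_right hQs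
  · exact (Finset.sdiff_disjoint).mono_left hPs
  · exact hmem (Finset.mem_sdiff.mp (hPs hh)).1
  · exact hmem (Finset.mem_sdiff.mp (Finset.mem_sdiff.mp (hQs hk)).1).1

theorem add_two_mul_le_primeCounting {p w X : ℕ} (hw : 64 ≤ w) (hwp : p < 2 ^ w) (hX0 : 1 ≤ X)
    (hHp : w ^ 3 * X < p) : w + 2 * (w * X) ≤ (w ^ 3 * X).primeCounting := by
  have hw3 : w ≤ w ^ 3 := Nat.le_self_pow (by norm_num) w
  have hH : w ^ 3 ≤ w ^ 3 * X := Nat.le_mul_of_pos_right _ hX0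
  have h1 := div_two_le_primeCounting_mul_log (N := w ^ 3 * X) (by omega)
  have hlog : Real.log ((w ^ 3 * X : ℕ) : ℝ) ≤ w := by
    have hpos : (0 : ℝ) < ((w ^ 3 * X : ℕ) : ℝ) := by
      exact_mod_cast (by omega : 0 < w ^ 3 * X)
    have h2 : ((w ^ 3 * X : ℕ) : ℝ) ≤ (2 : ℝ) ^ w := by exact_mod_cast (hHp.trans hwp).le
    have h3 := Real.log_le_log hpos h2
    rw [Real.log_pow] at h3
    have h4 := Real.log_two_lt_d9
    have h5 : (0 : ℝ) ≤ w := by positivity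
    nlinarith
  have h2 : ((w ^ 3 * X : ℕ) : ℝ) / 2 ≤ (w ^ 3 * X).primeCounting * w :=
    h1.trans (by gcongr)
  have h3 : w ^ 3 * X ≤ 2 * ((w ^ 3 * X).primeCounting * w) := by
    have : ((w ^ 3 * X : ℕ) : ℝ) ≤ 2 * ((w ^ 3 * X).primeCounting * w) := by linarith
    exact_mod_cast this
  have h4 : w ^ 2 * X ≤ 2 * (w ^ 3 * X).primeCounting := by
    refine le_of_mul_le_mul_left (a := w) ?_ (by omega)
    calc w * (w ^ 2 * X) = w ^ 3 * X := by ring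
      _ ≤ _ := h3
      _ = _ := by ring
  have h5 : w * 1 ≤ w * X := Nat.mul_le_mul_left _ hX0
  have h6 : 64 * (w * X) ≤ w * (w * X) := Nat.mul_le_mul_right _ hw
  have h7 : w ^ 2 * X = w * (w * X) := by ring
  omega

theorem add_mul_le_mul_mul {p w X s t : ℕ} (hw : 64 ≤ w) (hs : p < s.succ ^ 2) (hsX : s ≤ X ^ 2)
    (hs64 : 64 ≤ s) (ht1 : 4 * t ≤ s) (ht2 : s ≤ 8 * t) :
    t + 3 * w * p ≤ t * ((w * X) * (w * X)) := by
  have h1 : 3 * w * p ≤ 3 * w * (2 * s ^ 2) :=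
    Nat.mul_le_mul_left _ (hs.le.trans (by rw [Nat.succ_eq_add_one]; nlinarith))
  have h2 : t * w ^ 2 * s ≤ t * w ^ 2 * X ^ 2 := Nat.mul_le_mul_left _ hsX
  have h3 : s * (w ^ 2 * s) ≤ 8 * t * (w ^ 2 * s) := Nat.mul_le_mul_right _ ht2
  have h4 : 64 * (w * s ^ 2) ≤ w * (w * s ^ 2) := Nat.mul_le_mul_right _ hw
  have h5 : 1 * s ≤ w * s ^ 2 := Nat.mul_le_mul (by omega) (Nat.le_self_pow two_ne_zero s)
  nlinarith

theorem exists_squarefree_quadraticChar_ne_neg_one {p : ℕ} [Fact p.Prime] (hp : Odd p)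
    {a : ZMod p} (ha : a ≠ 0) {w X : ℕ} (hw : 64 ≤ w) (hwp : p < 2 ^ w) (hX : p ≤ X ^ 4)
    (hXp : (w ^ 3 * X) ^ 2 < p) :
    ∃ h k : ℕ, Squarefree h ∧ Squarefree k ∧ 1 ≤ h ∧ 1 ≤ k ∧ h ≤ w ^ 6 * X ∧ k ≤ w ^ 6 * X ∧
      (h : ZMod p) ≠ 0 ∧ (k : ZMod p) ≠ 0 ∧
      quadraticChar (ZMod p) (1 - a / ((h * k : ℕ) : ZMod p)) ≠ -1 := by
  have hp0 : 0 < p := (Fact.out : p.Prime).pos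
  have hX0 : 1 ≤ X := by
    by_contra h
    have : X = 0 := by omega
    subst this; simp at hX; omega
  have hw3 : w ≤ w ^ 3 := Nat.le_self_pow (by norm_num) w
  have hH : w ^ 3 ≤ w ^ 3 * X := Nat.le_mul_of_pos_right _ hX0
  have hHp : w ^ 3 * X < p := lt_of_le_of_lt (Nat.le_self_pow two_ne_zero _) hXp
  have hpi := add_two_mul_le_primeCounting hw hwp hX0 hHp
  obtain ⟨V, P, Q, hVc, hPc, hQc, hPQ, hPV, hV, hP, hQ⟩ := exists_prime_finsets (by omega) hpi
  have hs1 := Nat.sqrt_le' p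
  have hs2 := Nat.lt_succ_sqrt' p
  set s := Nat.sqrt p
  have hsX : s ≤ X ^ 2 := by
    have : s ^ 2 ≤ (X ^ 2) ^ 2 := hs1.trans (hX.trans_eq (by ring))
    exact (Nat.pow_le_pow_iff_left two_ne_zero).mp this
  have hs64 : 64 ≤ s := by
    rw [Nat.le_sqrt']
    calc 64 ^ 2 ≤ w ^ 2 := Nat.pow_le_pow_left hw 2
      _ ≤ (w ^ 3 * X) ^ 2 := Nat.pow_le_pow_left (hw3.trans hH) 2
      _ ≤ p := hXp.le
  obtain ⟨t, ht⟩ : ∃ t, t = s / 4 := ⟨_, rfl⟩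
  have ht1 : 4 * t ≤ s := by omega
  have ht2 : s ≤ 8 * t := by omega
  have hmain := add_mul_le_mul_mul hw hs2 hsX (by omega) ht1 ht2
  have hcard : t * p + 2 ^ V.card * (3 * V.card * p) < t * (2 ^ V.card * (P.card * Q.card)) := by
    rw [hVc, hPc, hQc]
    calc t * p + 2 ^ w * (3 * w * p) < t * 2 ^ w + 2 ^ w * (3 * w * p) := by
          have : t * p < t * 2 ^ w := Nat.mul_lt_mul_of_pos_left hwp (by omega)
          omega
      _ = 2 ^ w * (t + 3 * w * p) := by ring
      _ ≤ 2 ^ w * (t * ((w * X) * (w * X))) := Nat.mul_le_mul_left _ hmain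
      _ = _ := by ring
  obtain ⟨v, hv, h, hh, k, hk, hχ⟩ := exists_quadraticChar_ne_neg_one hp ha
    (fun v hv => ⟨(hV v hv).1, by have := (hV v hv).2; omega⟩) (fun h hh => (hP h hh).1)
    (fun k hk => (hQ k hk).1) hPQ
    (fun h hh k hk => lt_of_le_of_lt (by rw [sq]; exact Nat.mul_le_mul (hP h hh).2 (hQ k hk).2) hXp)
    (by omega) (by nlinarith) (by
      rw [hVc]
      have : 4 * w ≤ w ^ 3 := by
        calc 4 * w ≤ w ^ 2 * w := Nat.mul_le_mul_right _ (by nlinarith)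
          _ = w ^ 3 := by ring
      omega) hcard
  have hne : ∀ q : ℕ, q.Prime → q < p → (q : ZMod p) ≠ 0 := fun q hq hqp => by
    rw [Ne, ZMod.natCast_eq_zero_iff]
    exact Nat.not_dvd_of_pos_of_lt hq.pos hqp
  have hw6 : w ^ 3 * X * w ^ 3 = w ^ 6 * X := by ring
  have h1 := hP h hh
  have h2 := hQ k hk
  have h3 := hV v hv
  refine ⟨h * v, k, ?_, h2.1.squarefree, Nat.mul_pos h1.1.pos h3.1.pos, h2.1.one_le, ?_, ?_, ?_,
    hne k h2.1 (by omega), hχ⟩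
  · rw [Nat.squarefree_mul ((Nat.coprime_primes h1.1 h3.1).mpr
      (Finset.disjoint_iff_ne.mp hPV h hh v hv))]
    exact ⟨h1.1.squarefree, h3.1.squarefree⟩
  · rw [← hw6]; exact Nat.mul_le_mul h1.2 h3.2
  · rw [← hw6]; exact h2.2.trans (Nat.le_mul_of_pos_right _ (by positivity))
  · push_cast
    exact mul_ne_zero (hne h h1.1 (by omega)) (hne v h3.1 (by omega))

open Filter in
theorem eventually_mul_log_pow_lt_exp_sqrt_log :
    ∀ᶠ p : ℕ in atTop, 64 ≤ Real.log p ∧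
      2916 * Real.log p ^ 6 < Real.exp (√(Real.log p)) := by
  have hlog : Tendsto (fun p : ℕ => Real.log p) atTop atTop :=
    Real.tendsto_log_atTop.comp tendsto_natCast_atTop_atTop
  have hsqrt : Tendsto (fun p : ℕ => √(Real.log p)) atTop atTop :=
    Real.tendsto_sqrt_atTop.comp hlog
  have hexp := (Real.tendsto_exp_div_pow_atTop 12).comp hsqrt
  filter_upwards [hlog.eventually_ge_atTop 64, hexp.eventually_gt_atTop 2916] with p h1 h2
  refine ⟨h1, ?_⟩
  have hpos : 0 < √(Real.log p) := Real.sqrt_pos.mpr (by linarith)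
  simp only [Function.comp_apply] at h2
  rw [lt_div_iff₀ (by positivity)] at h2
  have h3 : √(Real.log p) ^ 12 = Real.log p ^ 6 := by
    rw [show (12 : ℕ) = 2 * 6 by norm_num, pow_mul, Real.sq_sqrt (by linarith)]
  rwa [h3] at h2

theorem exists_parameters_of_log_pow_lt {ε : ℝ} (hε : 0 < ε) {p : ℕ} (h64 : 64 ≤ Real.log p)
    (hlt : 2916 * Real.log p ^ 6 < Real.exp (√(Real.log p))) :
    ∃ w X : ℕ, 64 ≤ w ∧ p < 2 ^ w ∧ p ≤ X ^ 4 ∧ (w ^ 3 * X) ^ 2 < p ∧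
      ((w ^ 6 * X : ℕ) : ℝ) ≤ (p : ℝ) ^ ((1 : ℝ) / 4) *
        Real.exp ((Real.log p) ^ ((1 : ℝ) / 2 + ε)) := by
  set L := Real.log p
  have hp0 : p ≠ 0 := by rintro rfl; simp [L] at h64; linarith
  have hpR : (0 : ℝ) < p := by positivity
  have hexpL : Real.exp L = p := Real.exp_log hpR
  have hp1 : (1 : ℝ) ≤ p := by exact_mod_cast Nat.one_le_iff_ne_zero.mpr hp0
  set x := (p : ℝ) ^ ((1 : ℝ) / 4) with hx
  have hx1 : 1 ≤ x := Real.one_le_rpow hp1 (by norm_num)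
  have hx4 : x ^ 4 = p := by
    rw [hx, ← Real.rpow_natCast, ← Real.rpow_mul hpR.le]; norm_num
  have hlog2 := Real.log_two_gt_d9
  have hlog2' := Real.log_two_lt_d9
  have hwlt : p < 2 ^ (Nat.log 2 p + 1) := Nat.lt_pow_succ_log_self (by norm_num) p
  have hwle : 2 ^ Nat.log 2 p ≤ p := Nat.pow_log_le_self 2 hp0
  set w := Nat.log 2 p + 1 with hw
  have hLw : L ≤ w := by
    have h1 : (p : ℝ) ≤ 2 ^ w := by exact_mod_cast hwlt.le
    have h2 := Real.log_le_log hpR h1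
    rw [Real.log_pow] at h2
    have : (0 : ℝ) ≤ w := by positivity
    nlinarith
  have hwL : (w : ℝ) ≤ 3 * L := by
    have h1 : (2 : ℝ) ^ Nat.log 2 p ≤ p := by exact_mod_cast hwle
    have h2 := Real.log_le_log (by positivity) h1
    rw [Real.log_pow] at h2
    have : (w : ℝ) = Nat.log 2 p + 1 := by rw [hw]; push_cast; ring
    nlinarith
  have hX1 : x ≤ ⌈x⌉₊ := Nat.le_ceil x
  have hX2 : (⌈x⌉₊ : ℝ) ≤ 2 * x := by
    have := Nat.ceil_lt_add_one (by linarith : 0 ≤ x)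
    linarith
  set X := ⌈x⌉₊
  have hw6 : (w : ℝ) ^ 6 ≤ 729 * L ^ 6 := by
    calc (w : ℝ) ^ 6 ≤ (3 * L) ^ 6 := by gcongr
      _ = _ := by ring
  have hsq : √L ^ 2 = L := Real.sq_sqrt (by linarith)
  have hs8 : 8 ≤ √L := Real.le_sqrt_of_sq_le (by norm_num; exact h64)
  refine ⟨w, X, ?_, hwlt, ?_, ?_, ?_⟩
  · exact_mod_cast h64.trans hLw
  · have : (p : ℝ) ≤ (X : ℝ) ^ 4 := by rw [← hx4]; gcongr
    exact_mod_cast this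
  · have h1 : Real.exp √L ≤ x ^ 2 := by
      have h2 : x ^ 2 = Real.exp (L / 2) := by
        rw [hx, Real.rpow_def_of_pos hpR, ← Real.exp_nat_mul]
        congr 1; push_cast; ring
      rw [h2]
      exact Real.exp_le_exp.mpr (by nlinarith)
    have h3 : ((w : ℝ) ^ 3 * X) ^ 2 < p := by
      calc ((w : ℝ) ^ 3 * X) ^ 2 = w ^ 6 * X ^ 2 := by ring
        _ ≤ 729 * L ^ 6 * (2 * x) ^ 2 := by gcongr
        _ = 2916 * L ^ 6 * x ^ 2 := by ring
        _ < x ^ 2 * x ^ 2 := by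
            have : 2916 * L ^ 6 < x ^ 2 := hlt.trans_le h1
            gcongr
        _ = p := by rw [← hx4]; ring
    exact_mod_cast h3
  · have h1 : √L ≤ L ^ ((1 : ℝ) / 2 + ε) := by
      rw [Real.sqrt_eq_rpow]
      exact Real.rpow_le_rpow_of_exponent_le (by linarith) (by linarith)
    push_cast
    calc (w : ℝ) ^ 6 * X ≤ 729 * L ^ 6 * (2 * x) := by gcongr
      _ = x * (1458 * L ^ 6) := by ring
      _ ≤ x * Real.exp (L ^ ((1 : ℝ) / 2 + ε)) := by
          have : 1458 * L ^ 6 ≤ Real.exp (L ^ ((1 : ℝ) / 2 + ε)) := by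
            have := Real.exp_le_exp.mpr h1
            have : 0 ≤ L ^ 6 := by positivity
            linarith
          gcongr

/-- For every `ε > 0` there is `C_ε > 0` such that for every prime `p > 2` and every `c`
coprime to `p`, there are a point `(x, y) ∈ H_p^c` and squarefree positive integers
`h, k ≤ C_ε p^{1/4} exp((log p)^{1/2+ε})` with `(x + h)(y + k) ≡ c (mod p)`. -/
theorem modular_hyperbola_close_points_squarefree :
    ∀ ε : ℝ, 0 < ε →
    ∃ C : ℝ, 0 < C ∧
      ∀ p : ℕ, p.Prime → 2 < p → ∀ c : ℤ, Int.gcd c (p : ℤ) = 1 →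
        ∃ x y : ℤ, (x, y) ∈ ModularHyperbola p c ∧
          ∃ h k : ℕ, Squarefree h ∧ Squarefree k ∧
            1 ≤ h ∧ (h : ℝ) ≤ C * (p : ℝ) ^ ((1 : ℝ) / 4) *
                Real.exp ((Real.log p) ^ ((1 : ℝ) / 2 + ε)) ∧
            1 ≤ k ∧ (k : ℝ) ≤ C * (p : ℝ) ^ ((1 : ℝ) / 4) *
                Real.exp ((Real.log p) ^ ((1 : ℝ) / 2 + ε)) ∧
            (x + (h : ℤ)) * (y + (k : ℤ)) ≡ c [ZMOD (p : ℤ)] := by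
  intro ε hε
  obtain ⟨P₀, hP₀⟩ := Filter.eventually_atTop.mp eventually_mul_log_pow_lt_exp_sqrt_log
  have hsmall : ∀ p : ℕ, ∃ B : ℕ, ∀ (_ : Fact p.Prime), Odd p → ∀ c : ZMod p, c ≠ 0 →
      ∃ h : ℕ, h ≤ B ∧ 1 ≤ h ∧ Squarefree h ∧ (h : ZMod p) = 4 * c := by
    intro p
    by_cases hp : p.Prime ∧ Odd p
    · have : Fact p.Prime := ⟨hp.1⟩
      choose! g hg using fun (c : ZMod p) (hc : c ≠ 0) =>
        exists_squarefree_natCast_eq_four_mul hp.2 c hc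
      exact ⟨Finset.univ.sup g, fun _ _ c hc =>
        ⟨g c, Finset.le_sup (Finset.mem_univ c), hg c hc⟩⟩
    · exact ⟨0, fun hp1 hp2 => absurd ⟨hp1.out, hp2⟩ hp⟩
  choose B hB using hsmall
  refine ⟨1 + ∑ q ∈ Finset.range P₀, (B q : ℝ), by positivity, ?_⟩
  intro p hpp hp2 c hc
  have : Fact p.Prime := ⟨hpp⟩
  have hodd : Odd p := hpp.odd_of_ne_two (by omega)
  have hc0 : (c : ZMod p) ≠ 0 := by
    rw [Ne, ZMod.intCast_zmod_eq_zero_iff_dvd]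
    intro hdvd
    have h2 : (p : ℤ) ∣ (Int.gcd c p : ℤ) := Int.dvd_coe_gcd hdvd dvd_rfl
    rw [hc] at h2
    have h3 : p ∣ 1 := by exact_mod_cast h2
    exact hpp.one_lt.ne' (Nat.dvd_one.mp h3)
  have h4 : ((4 : ℕ) : ZMod p) ≠ 0 := natCast_four_ne_zero hodd
  have hp1 : (1 : ℝ) ≤ p := by exact_mod_cast hpp.one_le
  have hx1 : 1 ≤ (p : ℝ) ^ ((1 : ℝ) / 4) := Real.one_le_rpow hp1 (by norm_num)
  have he1 : 1 ≤ Real.exp ((Real.log p) ^ ((1 : ℝ) / 2 + ε)) :=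
    Real.one_le_exp (Real.rpow_nonneg (Real.log_nonneg hp1) _)
  have hS0 : 0 ≤ ∑ q ∈ Finset.range P₀, (B q : ℝ) := by positivity
  set M := (p : ℝ) ^ ((1 : ℝ) / 4) * Real.exp ((Real.log p) ^ ((1 : ℝ) / 2 + ε)) with hM
  have hM1 : 1 ≤ M := one_le_mul_of_one_le_of_one_le hx1 he1
  simp only [mul_assoc (1 + ∑ q ∈ Finset.range P₀, (B q : ℝ)), ← hM]
  rcases lt_or_ge p P₀ with hsm | hlarge
  · obtain ⟨h, hhB, hh1, hhs, hhc⟩ := hB p ‹_› hodd c hc0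
    have hh0 : (h : ZMod p) ≠ 0 := by
      rw [hhc]; exact mul_ne_zero (by exact_mod_cast h4) hc0
    obtain ⟨x, y, hxy, hcong⟩ := exists_hyperbola_points hodd hc0 (h := h) (k := 1) (by simp) hh0
      (by rw [mul_one, ← hhc, div_self hh0]; simp)
    have hBS : (B p : ℝ) ≤ ∑ q ∈ Finset.range P₀, (B q : ℝ) :=
      Finset.single_le_sum (f := fun q => (B q : ℝ)) (fun q _ => by positivity)
        (Finset.mem_range.mpr hsm)
    have hhB' : (h : ℝ) ≤ B p := by exact_mod_cast hhB
    refine ⟨x, y, hxy, h, 1, hhs, squarefree_one, hh1, ?_, le_rfl, ?_, hcong⟩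
    · nlinarith
    · push_cast; nlinarith
  · obtain ⟨h64, hlt⟩ := hP₀ p hlarge
    obtain ⟨w, X, hw, hwp, hX, hXp, hbound⟩ := exists_parameters_of_log_pow_lt hε h64 hlt
    obtain ⟨h, k, hhs, hks, hh1, hk1, hhX, hkX, hh0, hk0, hχ⟩ :=
      exists_squarefree_quadraticChar_ne_neg_one hodd (a := 4 * (c : ZMod p))
        (mul_ne_zero (by exact_mod_cast h4) hc0) hw hwp hX hXp
    obtain ⟨x, y, hxy, hcong⟩ := exists_hyperbola_points hodd hc0 hk0 hh0 hχ
    have hhX' : (h : ℝ) ≤ (w ^ 6 * X : ℕ) := by exact_mod_cast hhX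
    have hkX' : (k : ℝ) ≤ (w ^ 6 * X : ℕ) := by exact_mod_cast hkX
    refine ⟨x, y, hxy, h, k, hhs, hks, hh1, ?_, hk1, ?_, hcong⟩ <;> nlinarith
end

section
/- Let p > 2 be a prime and c an integer with gcd(c, p) = 1. Let h, k be integers not divisible by p such that the Legendre symbol (h·k·(h·k − 4c) / p) = 1. Then there exist integers x, y such that x·y ≡ c (mod p) and (x + h)·(y + k) ≡ c (mod p). -/
/-- Let `p > 2` be prime, `gcd(c, p) = 1`, and `h, k` integers not divisible by `p` with
Legendre symbol `(hk(hk - 4c) / p) = 1`. Then there are integers `x, y` with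
`x y ≡ c (mod p)` and `(x + h)(y + k) ≡ c (mod p)`. -/
theorem exists_close_points_of_legendre_eq_one (p : ℕ) [Fact p.Prime] (hp : 2 < p)
    (c : ℤ) (hc : Int.gcd c (p : ℤ) = 1) (h k : ℤ)
    (hh : ¬ (p : ℤ) ∣ h) (hk : ¬ (p : ℤ) ∣ k)
    (hleg : legendreSym p (h * k * (h * k - 4 * c)) = 1) :
    ∃ x y : ℤ, x * y ≡ c [ZMOD (p : ℤ)] ∧ (x + h) * (y + k) ≡ c [ZMOD (p : ℤ)] := by
  have h2 : (2 : ZMod p) ≠ 0 := Ring.two_ne_zero (by rw [ZMod.ringChar_zmod_n]; exact hp.ne')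
  have hh0 : (h : ZMod p) ≠ 0 := by rwa [Ne, ZMod.intCast_zmod_eq_zero_iff_dvd]
  have hk0 : (k : ZMod p) ≠ 0 := by rwa [Ne, ZMod.intCast_zmod_eq_zero_iff_dvd]
  have hsq : IsSquare ((h * k * (h * k - 4 * c) : ℤ) : ZMod p) := by
    by_contra hns
    rw [legendreSym.eq_neg_one_iff p |>.mpr hns] at hleg
    norm_num at hleg
  obtain ⟨s, hs⟩ := hsq
  push_cast at hs
  obtain ⟨x, hx⟩ := ZMod.intCast_surjective ((s - h * k) / (2 * k) : ZMod p)
  obtain ⟨y, hy⟩ := ZMod.intCast_surjective (-(s + h * k) / (2 * h) : ZMod p)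
  refine ⟨x, y, (ZMod.intCast_eq_intCast_iff _ _ _).mp ?_,
    (ZMod.intCast_eq_intCast_iff _ _ _).mp ?_⟩
  · push_cast
    rw [hx, hy]
    field_simp
    linear_combination hs
  · push_cast
    rw [hx, hy]
    field_simp
    linear_combination hs
end
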